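/- arXiv:2605.25914 — 4 statements merged into one kernel-verified Lean document; each statement's English description precedes it below -/
import Mathlib

section
/- Let Γ be a finite group of order n, let S = S^{-1} ⊆ Γ \ {1_Γ} with |S| = D, and suppose that every eigenvalue of the adjacency operator of Cay(Γ,S) other than the trivial eigenvalue D has absolute value at most θ (with Cay(Γ,S) connected and non-bipartite). Let H be the 3-partite 3-graph with vertex classes X, Y, Z, each a disjoint copy of Γ, whose edges are the triples {x,y,z} with (x,y,z) ∈ X×Y×Z such that z = x·s·y for some s ∈ S, and put m := 3n. Then λ(H) ≤ 2/9, and moreover for every probability vector y on V(H): P_H(y) ≤ 2D/(3m) + θ·(Σ_{v∈V(H)} y_v² − 1/m). -/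
open Filter Finset

/-- The Cayley graph `Cay(Γ,S)`. -/
def cayleyGraph {Γ : Type*} [Group Γ] (S : Finset Γ) : SimpleGraph Γ :=
  SimpleGraph.fromRel (fun g h => ∃ s ∈ S, h = g * s)

/-- The adjacency operator of `Cay(Γ,S)`: `(Mh)(u) = Σ_{s∈S} h(us)`. -/
noncomputable def adjOp {Γ : Type*} [Group Γ] [Fintype Γ] (S : Finset Γ)
    (h : Γ → ℝ) : Γ → ℝ :=
  fun u => ∑ s ∈ S, h (u * s)

/-- The edge set of the 3-partite spectral gadget `H`: vertex classes are three
disjoint copies of `Γ` (the summands of `Γ ⊕ Γ ⊕ Γ`), and `{x, y, z}` is an edge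
iff `z = x·s·y` for some `s ∈ S`. -/
def gadgetEdges {Γ : Type*} [Group Γ] [Fintype Γ] [DecidableEq Γ] (S : Finset Γ) :
    Finset (Finset (Γ ⊕ Γ ⊕ Γ)) :=
  ((Finset.univ : Finset Γ) ×ˢ (Finset.univ : Finset Γ) ×ˢ S).image
    (fun p => {Sum.inl p.1, Sum.inr (Sum.inl p.2.1),
               Sum.inr (Sum.inr (p.1 * p.2.2 * p.2.1))})

/-- The Lagrangian polynomial of a `3`-graph with edge set `E`:
`P(y) = 3!·Σ_{e∈E} Π_{v∈e} y_v`. -/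
noncomputable def lagPoly3 {V : Type*} [Fintype V] (E : Finset (Finset V))
    (y : V → ℝ) : ℝ :=
  6 * ∑ e ∈ E, ∏ v ∈ e, y v

/-- The Lagrangian of a `3`-graph with edge set `E`: the maximum of the Lagrangian
polynomial over probability vectors. -/
noncomputable def lag3 {V : Type*} [Fintype V] (E : Finset (Finset V)) : ℝ :=
  sSup { t : ℝ | ∃ y : V → ℝ, (∀ v, 0 ≤ y v) ∧ (∑ v, y v) = 1 ∧ t = lagPoly3 E y }

section SymmetricOperators

variable {E : Type*} [NormedAddCommGroup E] [InnerProductSpace ℝ E] [FiniteDimensional ℝ E]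

/-- If every eigenvector of a symmetric operator not orthogonal to `f` has eigenvalue of absolute
value at most `θ`, then the quadratic form at `f` is at most `θ‖f‖²` in absolute value. -/
theorem abs_inner_apply_self_le_of_eigenvalues {T : E →ₗ[ℝ] E} (hT : T.IsSymmetric) {θ : ℝ} {f : E}
    (h : ∀ (μ : ℝ) (v : E), v ≠ 0 → T v = μ • v → |μ| ≤ θ ∨ inner ℝ v f = 0) :
    |inner ℝ f (T f)| ≤ θ * ‖f‖ ^ 2 := by
  set b := hT.eigenvectorBasis rfl
  set μ := hT.eigenvalues rfl
  have hb (i) : T (b i) = μ i • b i := hT.apply_eigenvectorBasis rfl i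
  have hquad : inner ℝ f (T f) = ∑ i, μ i * inner ℝ (b i) f ^ 2 := by
    rw [← b.sum_inner_mul_inner]
    refine sum_congr rfl fun i _ => ?_
    rw [← hT, hb, real_inner_smul_left, real_inner_comm]
    ring
  rw [hquad, ← b.sum_sq_inner_right f, mul_sum]
  refine (abs_sum_le_sum_abs _ _).trans (sum_le_sum fun i _ => ?_)
  rw [abs_mul, abs_of_nonneg (sq_nonneg (inner ℝ (b i) f))]
  rcases h (μ i) (b i) (b.orthonormal.ne_zero i) (hb i) with hi | hi
  · exact mul_le_mul_of_nonneg_right hi (sq_nonneg _)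
  · simp [hi]

end SymmetricOperators

section CayleySpectrum

variable {Γ : Type*} [Group Γ] {S : Finset Γ}

theorem sum_comp_inv_of_symm {M : Type*} [AddCommMonoid M] (hS : ∀ s ∈ S, s⁻¹ ∈ S) (F : Γ → M) :
    ∑ s ∈ S, F s⁻¹ = ∑ s ∈ S, F s :=
  sum_nbij' (·⁻¹) (·⁻¹) hS hS (by simp) (by simp) (by simp)

variable [Fintype Γ]

theorem sum_mul_adjOp_comm (hS : ∀ s ∈ S, s⁻¹ ∈ S) (f h : Γ → ℝ) :
    ∑ u, f u * adjOp S h u = ∑ u, adjOp S f u * h u := by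
  simp only [adjOp, mul_sum, sum_mul]
  rw [sum_comm, sum_comm (s := univ (α := Γ)), ← sum_comp_inv_of_symm hS]
  refine sum_congr rfl fun s _ => ?_
  exact Fintype.sum_equiv (Equiv.mulRight s⁻¹) _ _ (by simp)

/-- On a connected Cayley graph, the eigenfunctions of the trivial eigenvalue are constant. -/
theorem eq_of_adjOp_eq_card_mul (hS : ∀ s ∈ S, s⁻¹ ∈ S) (hconn : (cayleyGraph S).Connected)
    {h : Γ → ℝ} (hh : ∀ u, adjOp S h u = S.card * h u) (u v : Γ) : h u = h v := by
  obtain ⟨w, -, hw⟩ := exists_max_image univ h ⟨1, mem_univ _⟩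
  have hnbr (a : Γ) (ha : h a = h w) (s : Γ) (hs : s ∈ S) : h (a * s) = h w := by
    have hsum : ∑ t ∈ S, h (a * t) = ∑ _t ∈ S, h w := by
      simpa [adjOp, ha] using hh a
    exact (sum_eq_sum_iff_of_le fun t _ => hw (a * t) (mem_univ _)).1 hsum s hs
  have hall (a : Γ) : h a = h w := by
    obtain ⟨p⟩ := hconn.preconnected a w
    induction p with
    | nil => rfl
    | cons hadj p ih =>
      rename_i a b c
      have hb := ih hw hnbr
      rw [cayleyGraph, SimpleGraph.fromRel_adj] at hadj
      rcases hadj.2 with ⟨s, hs, rfl⟩ | ⟨s, hs, rfl⟩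
      · simpa using hnbr _ hb s⁻¹ (hS s hs)
      · exact hnbr _ hb s hs
  rw [hall, hall v]

/-- `adjOp S` as a linear operator on the Euclidean space of functions on `Γ`. -/
noncomputable def adjLin (S : Finset Γ) : EuclideanSpace ℝ Γ →ₗ[ℝ] EuclideanSpace ℝ Γ where
  toFun h := WithLp.toLp 2 (adjOp S h)
  map_add' f g := by
    ext u
    simp [adjOp, sum_add_distrib]
  map_smul' c f := by
    ext u
    simp [adjOp, mul_sum]

theorem adjLin_apply (h : EuclideanSpace ℝ Γ) (u : Γ) : adjLin S h u = adjOp S h u := rfl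

theorem isSymmetric_adjLin (hS : ∀ s ∈ S, s⁻¹ ∈ S) : (adjLin S).IsSymmetric := by
  intro f h
  simpa [PiLp.inner_apply, adjLin_apply, mul_comm] using sum_mul_adjOp_comm hS h f

/-- The nontrivial eigenvalues of `Cay(Γ,S)` are at most `θ` in absolute value. -/
def NontrivialEigenvaluesLe (S : Finset Γ) (θ : ℝ) : Prop :=
  ∀ μ : ℝ, μ ≠ (S.card : ℝ) → (∃ h : Γ → ℝ, h ≠ 0 ∧ adjOp S h = fun u => μ * h u) → |μ| ≤ θ

theorem abs_sum_mul_adjOp_le (hS : ∀ s ∈ S, s⁻¹ ∈ S) (hconn : (cayleyGraph S).Connected) {θ : ℝ}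
    (hθ : NontrivialEigenvaluesLe S θ) {f : Γ → ℝ} (hf : ∑ u, f u = 0) :
    |∑ u, f u * adjOp S f u| ≤ θ * ∑ u, f u ^ 2 := by
  have key := abs_inner_apply_self_le_of_eigenvalues (isSymmetric_adjLin hS)
    (θ := θ) (f := WithLp.toLp 2 f) fun μ v hv hTv => by
      have hMv (u) : adjOp S v u = μ * v u := by
        simpa [adjLin_apply] using congrArg (fun x : EuclideanSpace ℝ Γ => x u) hTv
      by_cases hμ : μ = S.card
      · right
        subst hμ
        have hconst (u) : v u = v 1 := eq_of_adjOp_eq_card_mul hS hconn hMv u 1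
        simp only [PiLp.inner_apply, hconst]
        simp [← sum_mul, hf]
      · refine .inl (hθ μ hμ ⟨v, fun h0 => hv ?_, funext hMv⟩)
        ext u
        exact congrFun h0 u
  rw [EuclideanSpace.norm_sq_eq] at key
  simpa [PiLp.inner_apply, adjLin_apply, mul_comm] using key

theorem nonneg_of_nontrivialEigenvaluesLe [Nontrivial Γ] (hS : ∀ s ∈ S, s⁻¹ ∈ S)
    (hconn : (cayleyGraph S).Connected) {θ : ℝ} (hθ : NontrivialEigenvaluesLe S θ) : 0 ≤ θ := by
  classical
  obtain ⟨a, ha⟩ := exists_ne (1 : Γ)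
  set f : Γ → ℝ := Pi.single a 1 - Pi.single 1 1 with hfdef
  have hf : ∑ u, f u = 0 := by simp [hfdef]
  have hpos : 0 < ∑ u, f u ^ 2 :=
    sum_pos' (fun u _ => sq_nonneg _) ⟨a, mem_univ _, by simp [hfdef, ha]⟩
  exact nonneg_of_mul_nonneg_left ((abs_nonneg _).trans (abs_sum_mul_adjOp_le hS hconn hθ hf)) hpos

theorem two_mul_sum_mul_adjOp_le_of_sum_eq_zero (hS : ∀ s ∈ S, s⁻¹ ∈ S)
    (hconn : (cayleyGraph S).Connected) {θ : ℝ} (hθ : NontrivialEigenvaluesLe S θ) {f h : Γ → ℝ}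
    (hf : ∑ u, f u = 0) (hh : ∑ u, h u = 0) :
    2 * ∑ u, f u * adjOp S h u ≤ θ * (∑ u, f u ^ 2 + ∑ u, h u ^ 2) := by
  have hadd := (abs_le.1 (abs_sum_mul_adjOp_le hS hconn hθ (f := f + h)
    (by simp [sum_add_distrib, hf, hh]))).2
  have hsub := (abs_le.1 (abs_sum_mul_adjOp_le hS hconn hθ (f := f - h)
    (by simp [hf, hh]))).1
  have hcomm := sum_mul_adjOp_comm hS f h
  have ea (u) : adjOp S (f + h) u = adjOp S f u + adjOp S h u := by simp [adjOp, sum_add_distrib]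
  have es (u) : adjOp S (f - h) u = adjOp S f u - adjOp S h u := by simp [adjOp]
  have e1 : ∑ u, (f + h) u * adjOp S (f + h) u - ∑ u, (f - h) u * adjOp S (f - h) u
      = 4 * ∑ u, f u * adjOp S h u := by
    have : 4 * ∑ u, f u * adjOp S h u
        = 2 * ∑ u, f u * adjOp S h u + 2 * ∑ u, adjOp S f u * h u := by rw [← hcomm]; ring
    rw [this, mul_sum, mul_sum, ← sum_add_distrib, ← sum_sub_distrib]
    refine sum_congr rfl fun u _ => ?_
    rw [ea, es, Pi.add_apply, Pi.sub_apply]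
    ring
  have e2 : ∑ u, (f + h) u ^ 2 + ∑ u, (f - h) u ^ 2 = 2 * (∑ u, f u ^ 2 + ∑ u, h u ^ 2) := by
    rw [← sum_add_distrib, ← sum_add_distrib, mul_sum]
    refine sum_congr rfl fun u _ => ?_
    rw [Pi.add_apply, Pi.sub_apply]
    ring
  linear_combination (hadd + hsub - e1 + θ * e2) / 2

/-- The expander mixing inequality for functions, in arithmetic-mean form. -/
theorem two_mul_sum_mul_adjOp_le (hS : ∀ s ∈ S, s⁻¹ ∈ S) (hconn : (cayleyGraph S).Connected)
    {θ : ℝ} (hθ : NontrivialEigenvaluesLe S θ) (f h : Γ → ℝ) :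
    2 * ∑ u, f u * adjOp S h u ≤
      2 * S.card * (∑ u, f u) * (∑ u, h u) / Fintype.card Γ
        + θ * ((∑ u, f u ^ 2 - (∑ u, f u) ^ 2 / Fintype.card Γ)
          + (∑ u, h u ^ 2 - (∑ u, h u) ^ 2 / Fintype.card Γ)) := by
  have hn : (Fintype.card Γ : ℝ) ≠ 0 := by simp
  have hzero (k : Γ → ℝ) : ∑ u, (k u - (∑ w, k w) / Fintype.card Γ) = 0 := by
    simp [field]
  have hsq (k : Γ → ℝ) : ∑ u, (k u - (∑ w, k w) / Fintype.card Γ) ^ 2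
      = ∑ u, k u ^ 2 - (∑ u, k u) ^ 2 / Fintype.card Γ := by
    simp only [sub_sq, sum_add_distrib, sum_sub_distrib, ← sum_mul, ← mul_sum]
    simp
    field_simp
    ring
  have hconst (c : ℝ) (u : Γ) : adjOp S (fun w => h w - c) u = adjOp S h u - S.card * c := by
    simp [adjOp]
  have htot : ∑ u, adjOp S h u = S.card * ∑ u, h u := by
    simp only [adjOp]
    rw [sum_comm, ← nsmul_eq_mul, ← sum_const]
    exact sum_congr rfl fun s _ => Equiv.sum_comp (Equiv.mulRight s) h
  have key := two_mul_sum_mul_adjOp_le_of_sum_eq_zero hS hconn hθ (hzero f) (hzero h)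
  rw [hsq, hsq] at key
  have hbil : ∑ u, (f u - (∑ w, f w) / Fintype.card Γ)
        * adjOp S (fun w => h w - (∑ w, h w) / Fintype.card Γ) u
      = ∑ u, f u * adjOp S h u - S.card * (∑ u, f u) * (∑ u, h u) / Fintype.card Γ := by
    simp only [hconst, sub_mul, mul_sub, sum_sub_distrib, ← sum_mul, ← mul_sum, htot]
    simp
    field_simp
    ring
  rw [hbil] at key
  linear_combination key

end CayleySpectrum

section Gadget

variable {Γ : Type*} [Group Γ] [Fintype Γ] {S : Finset Γ}

/-- The trilinear form of the gadget. -/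
noncomputable def gadgetForm (S : Finset Γ) (f g h : Γ → ℝ) : ℝ :=
  ∑ x, ∑ y, ∑ s ∈ S, f x * (g y * h (x * s * y))

theorem lagPoly3_gadgetEdges [DecidableEq Γ] (y : Γ ⊕ Γ ⊕ Γ → ℝ) :
    lagPoly3 (gadgetEdges S) y = 6 * gadgetForm S (fun a => y (.inl a))
      (fun a => y (.inr (.inl a))) (fun a => y (.inr (.inr a))) := by
  rw [lagPoly3, gadgetEdges, gadgetForm, sum_image, sum_product]
  · simp_rw [sum_product]
    simp
  · rintro ⟨a, b, s⟩ - ⟨a', b', s'⟩ - hab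
    simp only [Finset.ext_iff, mem_insert, mem_singleton] at hab
    have h1 := hab (.inl a)
    have h2 := hab (.inr (.inl b))
    have h3 := hab (.inr (.inr (a * s * b)))
    simp only [Sum.inl.injEq, Sum.inr.injEq, reduceCtorEq, or_false, false_or, true_iff] at h1 h2 h3
    subst h1 h2
    simpa using h3

theorem gadgetForm_eq_sum_mid (f g h : Γ → ℝ) :
    gadgetForm S f g h = ∑ t, g t * ∑ u, f u * adjOp S (fun w => h (w * t)) u := by
  rw [gadgetForm, sum_comm]
  simp only [adjOp, mul_sum]
  exact sum_congr rfl fun t _ => sum_congr rfl fun u _ => sum_congr rfl fun s _ => by ring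

theorem gadgetForm_eq_sum_left (hS : ∀ s ∈ S, s⁻¹ ∈ S) (f g h : Γ → ℝ) :
    gadgetForm S f g h = ∑ t, f t * ∑ u, g u⁻¹ * adjOp S (fun w => h (t * w⁻¹)) u := by
  rw [gadgetForm]
  simp only [adjOp, mul_sum]
  refine sum_congr rfl fun t _ => Fintype.sum_equiv (Equiv.inv Γ) _ _ fun y => ?_
  rw [← sum_comp_inv_of_symm hS]
  simp [mul_assoc]

theorem gadgetForm_eq_sum_right (hS : ∀ s ∈ S, s⁻¹ ∈ S) (f g h : Γ → ℝ) :
    gadgetForm S f g h = ∑ t, h t * ∑ u, g u⁻¹ * adjOp S (fun w => f (t * w)) u := by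
  rw [gadgetForm, sum_comm]
  simp only [adjOp, mul_sum]
  refine Eq.trans ?_ sum_comm
  refine Fintype.sum_equiv (Equiv.inv Γ) _ _ fun y => ?_
  rw [sum_comm, sum_comm (s := univ (α := Γ)), ← sum_comp_inv_of_symm hS]
  refine sum_congr rfl fun s _ => Fintype.sum_equiv (Equiv.mulRight (s⁻¹ * y)) _ _ fun x => ?_
  simp [mul_assoc]
  ring

theorem two_mul_sum_mul_sum_mul_adjOp_le (hS : ∀ s ∈ S, s⁻¹ ∈ S)
    (hconn : (cayleyGraph S).Connected) {θ : ℝ} (hθ : NontrivialEigenvaluesLe S θ)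
    {p q r : Γ → ℝ} (hp : ∀ t, 0 ≤ p t) (e : Γ ≃ Γ) (σ : Γ → Γ ≃ Γ) :
    2 * ∑ t, p t * ∑ u, q (e u) * adjOp S (fun w => r (σ t w)) u ≤
      (∑ t, p t) * (2 * S.card * (∑ u, q u) * (∑ u, r u) / Fintype.card Γ
        + θ * ((∑ u, q u ^ 2 - (∑ u, q u) ^ 2 / Fintype.card Γ)
          + (∑ u, r u ^ 2 - (∑ u, r u) ^ 2 / Fintype.card Γ))) := by
  rw [mul_sum, sum_mul]
  refine sum_le_sum fun t _ => ?_
  have key := two_mul_sum_mul_adjOp_le hS hconn hθ (fun u => q (e u)) (fun w => r (σ t w))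
  rw [Equiv.sum_comp e q, Equiv.sum_comp e (fun u => q u ^ 2), Equiv.sum_comp (σ t) r,
    Equiv.sum_comp (σ t) (fun u => r u ^ 2)] at key
  rw [mul_left_comm]
  exact mul_le_mul_of_nonneg_left key (hp t)

theorem mul_mul_le_of_add_eq_one {a b c : ℝ} (ha : 0 ≤ a) (hb : 0 ≤ b) (hc : 0 ≤ c)
    (h : a + b + c = 1) : a * b * c ≤ 1 / 27 := by
  obtain rfl : c = 1 - a - b := by linarith
  nlinarith [mul_nonneg ha (sq_nonneg (b - (1 - a - b))), mul_nonneg hb (sq_nonneg (a - (1 - a - b))),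
    mul_nonneg hc (sq_nonneg (a - b)), sq_nonneg (a - b), sq_nonneg (b - (1 - a - b)),
    sq_nonneg (a - (1 - a - b))]

theorem gadgetForm_le_mul {f g h : Γ → ℝ} (hf : ∀ u, 0 ≤ f u) (hg : ∀ u, 0 ≤ g u)
    (hh : ∀ u, 0 ≤ h u) :
    gadgetForm S f g h ≤ (∑ u, f u) * (∑ u, g u) * ∑ u, h u := by
  rw [gadgetForm, mul_assoc, sum_mul]
  refine sum_le_sum fun x _ => ?_
  rw [sum_mul, mul_sum]
  refine sum_le_sum fun y _ => ?_
  rw [← mul_sum, ← mul_sum]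
  refine mul_le_mul_of_nonneg_left (mul_le_mul_of_nonneg_left ?_ (hg y)) (hf x)
  calc ∑ s ∈ S, h (x * s * y) ≤ ∑ s, h (x * s * y) :=
        sum_le_sum_of_subset_of_nonneg (subset_univ _) fun s _ _ => hh _
    _ = ∑ u, h u := Equiv.sum_comp ((Equiv.mulLeft x).trans (Equiv.mulRight y)) h

theorem variance_nonneg (f : Γ → ℝ) : 0 ≤ ∑ u, f u ^ 2 - (∑ u, f u) ^ 2 / Fintype.card Γ := by
  rw [sub_nonneg, div_le_iff₀ (by simp [Fintype.card_pos]), mul_comm]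
  exact sq_sum_le_card_mul_sum_sq

/-- Bound for `6T` from a mixing estimate for `2T` in which the class of weight `π ≤ 1/3` has been
singled out. -/
theorem six_mul_le_of_le_third {T π κ ρ A B C D n θ : ℝ} (hθ : 0 ≤ θ) (hD : 0 ≤ D) (hn : 0 < n)
    (hA : 0 ≤ A) (hB : 0 ≤ B) (hC : 0 ≤ C) (hπ : π ≤ 1 / 3) (hprod : π * κ * ρ ≤ 1 / 27)
    (hT : 2 * T ≤ π * (2 * D * κ * ρ / n + θ * (B + C))) :
    6 * T ≤ 2 * D / (9 * n) + θ * (A + B + C) := by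
  have h1 : 0 ≤ (1 / 3 - π) * (θ * (B + C)) := mul_nonneg (by linarith) (by positivity)
  have h2 : 0 ≤ (D / n) * (1 / 27 - π * κ * ρ) := mul_nonneg (by positivity) (by linarith)
  have h3 : 0 ≤ θ * A := by positivity
  have e : 2 * D / (9 * n) = 6 * (D / n) * (1 / 27) := by ring
  rw [e]
  linear_combination 3 * hT + 3 * h1 + 6 * h2 + h3

theorem six_mul_gadgetForm_le [Nontrivial Γ] (hS : ∀ s ∈ S, s⁻¹ ∈ S)
    (hconn : (cayleyGraph S).Connected) {θ : ℝ} (hθ : NontrivialEigenvaluesLe S θ)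
    {f g h : Γ → ℝ} (hf : ∀ u, 0 ≤ f u) (hg : ∀ u, 0 ≤ g u) (hh : ∀ u, 0 ≤ h u)
    (hsum : ∑ u, f u + ∑ u, g u + ∑ u, h u = 1) :
    6 * gadgetForm S f g h ≤ 2 * S.card / (9 * Fintype.card Γ)
      + θ * (∑ u, f u ^ 2 + ∑ u, g u ^ 2 + ∑ u, h u ^ 2 - 1 / (3 * Fintype.card Γ)) := by
  have hθ0 := nonneg_of_nontrivialEigenvaluesLe hS hconn hθ
  have hn : (0 : ℝ) < Fintype.card Γ := by simp [Fintype.card_pos]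
  have hprod := mul_mul_le_of_add_eq_one (sum_nonneg fun u _ => hf u) (sum_nonneg fun u _ => hg u)
    (sum_nonneg fun u _ => hh u) hsum
  have hmid := two_mul_sum_mul_sum_mul_adjOp_le hS hconn hθ (q := f) (r := h) hg (Equiv.refl Γ)
    fun t => Equiv.mulRight t
  have hleft := two_mul_sum_mul_sum_mul_adjOp_le hS hconn hθ (q := g) (r := h) hf (Equiv.inv Γ)
    fun t => (Equiv.inv Γ).trans (Equiv.mulLeft t)
  have hright := two_mul_sum_mul_sum_mul_adjOp_le hS hconn hθ (q := g) (r := f) hh (Equiv.inv Γ)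
    fun t => Equiv.mulLeft t
  replace hmid := (congrArg (2 * ·) (gadgetForm_eq_sum_mid f g h)).trans_le hmid
  replace hleft := (congrArg (2 * ·) (gadgetForm_eq_sum_left hS f g h)).trans_le hleft
  replace hright := (congrArg (2 * ·) (gadgetForm_eq_sum_right hS f g h)).trans_le hright
  have hA := variance_nonneg f
  have hB := variance_nonneg g
  have hC := variance_nonneg h
  have hvar : 6 * gadgetForm S f g h ≤ 2 * S.card / (9 * Fintype.card Γ)
      + θ * ((∑ u, f u ^ 2 - (∑ u, f u) ^ 2 / Fintype.card Γ)
        + (∑ u, g u ^ 2 - (∑ u, g u) ^ 2 / Fintype.card Γ)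
        + (∑ u, h u ^ 2 - (∑ u, h u) ^ 2 / Fintype.card Γ)) := by
    have hD : (0 : ℝ) ≤ S.card := by positivity
    rcases le_or_gt (∑ u, f u) (1 / 3) with h1 | h1
    · exact six_mul_le_of_le_third hθ0 hD hn hA hB hC h1 hprod hleft
    rcases le_or_gt (∑ u, g u) (1 / 3) with h2 | h2
    · have := six_mul_le_of_le_third hθ0 hD hn hB hA hC h2 (by linarith) hmid
      linarith
    · have := six_mul_le_of_le_third hθ0 hD hn hC hB hA (by linarith) (by linarith) hright
      linarith
  refine hvar.trans (add_le_add le_rfl (mul_le_mul_of_nonneg_left ?_ hθ0))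
  have hsq : 1 / 3 ≤ (∑ u, f u) ^ 2 + (∑ u, g u) ^ 2 + (∑ u, h u) ^ 2 := by
    nlinarith [sq_nonneg (∑ u, f u - 1 / 3), sq_nonneg (∑ u, g u - 1 / 3),
      sq_nonneg (∑ u, h u - 1 / 3)]
  have := div_le_div_of_nonneg_right hsq hn.le
  linear_combination this

end Gadget

/-- The spectral gadget `H` built from a Cayley graph whose non-trivial eigenvalues
are bounded by `θ` satisfies `λ(H) ≤ 2/9`, and moreover
`P_H(y) ≤ 2D/(3m) + θ·(Σ_v y_v² − 1/m)` for every probability vector `y`,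
where `m = 3n` is the number of vertices of `H`. -/
theorem gadget_lagrangian_bound {Γ : Type*} [Group Γ] [Fintype Γ] [DecidableEq Γ]
    (S : Finset Γ)
    (hS1 : (1 : Γ) ∉ S) (hSsymm : ∀ s ∈ S, s⁻¹ ∈ S)
    (D n m : ℕ) (hD : D = S.card) (hn : n = Fintype.card Γ) (hm : m = 3 * n)
    (θ : ℝ)
    (hconn : (cayleyGraph S).Connected)
    (hnonbip : ¬ (cayleyGraph S).Colorable 2)
    (heig : ∀ μ : ℝ, μ ≠ (D : ℝ) →
      (∃ h : Γ → ℝ, h ≠ 0 ∧ adjOp S h = fun u => μ * h u) → |μ| ≤ θ) :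
    lag3 (gadgetEdges S) ≤ 2 / 9 ∧
    (∀ y : (Γ ⊕ Γ ⊕ Γ) → ℝ, (∀ v, 0 ≤ y v) → (∑ v, y v) = 1 →
      lagPoly3 (gadgetEdges S) y ≤
        2 * (D : ℝ) / (3 * (m : ℝ)) + θ * ((∑ v, (y v) ^ 2) - 1 / (m : ℝ))) := by
  subst hD hn hm
  have split (F : Γ ⊕ Γ ⊕ Γ → ℝ) : ∑ v, F v
      = ∑ u, F (.inl u) + ∑ u, F (.inr (.inl u)) + ∑ u, F (.inr (.inr u)) := by
    rw [Fintype.sum_sum_type, Fintype.sum_sum_type, add_assoc]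
  constructor
  · refine Real.sSup_le ?_ (by norm_num)
    rintro _ ⟨y, hy, hsum, rfl⟩
    rw [split] at hsum
    rw [lagPoly3_gadgetEdges]
    have h1 := gadgetForm_le_mul (S := S) (fun u => hy (.inl u)) (fun u => hy (.inr (.inl u)))
      (fun u => hy (.inr (.inr u)))
    have h2 := mul_mul_le_of_add_eq_one (sum_nonneg fun u _ => hy (.inl u))
      (sum_nonneg fun u _ => hy (.inr (.inl u))) (sum_nonneg fun u _ => hy (.inr (.inr u))) hsum
    linarith
  · intro y hy hsum
    have : Nontrivial Γ := by
      by_contra hΓ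
      rw [not_nontrivial_iff_subsingleton] at hΓ
      exact hnonbip ⟨SimpleGraph.Coloring.mk (fun _ => 0)
        fun {a b} hab => (hab.ne (Subsingleton.elim a b)).elim⟩
    rw [split] at hsum
    rw [lagPoly3_gadgetEdges, split]
    refine (six_mul_gadgetForm_le hSsymm hconn heig (fun u => hy (.inl u))
      (fun u => hy (.inr (.inl u))) (fun u => hy (.inr (.inr u))) hsum).trans_eq ?_
    push_cast
    ring
end

section
/- Let (m_j)_{j≥1} be a strictly increasing sequence of positive integers with m_j → ∞ and m_{j+1}/m_j → 1, and let (a_j)_{j≥1} be a real sequence satisfying a_j = (c + o(1))/m_j for some constant c > 0. Then there is a subsequence j₁ < j₂ < j₃ < ⋯ such that a_{j₁} > a_{j₂} > a_{j₃} > ⋯ (strictly decreasing) and m_{j_{i+1}}/m_{j_i} → 1 as i → ∞; consequently a_{j_i}/a_{j_{i+1}} → 1. -/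
open Filter

/-- Before a sequence first drops strictly below the value `a j`, it is still at least `a j`. -/
theorem exists_first_drop {a : ℕ → ℝ} (ha : Tendsto a atTop (nhds 0)) {j : ℕ} (hj : 0 < a j) :
    ∃ p, j ≤ p ∧ a j ≤ a p ∧ a (p + 1) < a j := by
  by_contra! h
  have hle : ∀ k, j ≤ k → a j ≤ a k := fun k hk =>
    Nat.le_induction le_rfl (fun n hn ih => h n hn ih) k hk
  exact absurd (ge_of_tendsto ha (eventually_atTop.2 ⟨j, hle⟩)) (not_le.2 hj)

/-- Extraction lemma: if `m_j` is a strictly increasing sequence of positive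
integers with `m_j → ∞` and `m_{j+1}/m_j → 1`, and `a_j = (c + o(1))/m_j`
(i.e. `m_j·a_j → c`) with `c > 0`, then there is a subsequence `φ` along which
`a` is strictly decreasing, `m_{φ(i+1)}/m_{φ(i)} → 1`, and consequently
`a_{φ(i)}/a_{φ(i+1)} → 1`. -/
theorem extraction_lemma (m : ℕ → ℕ) (hpos : ∀ j, 0 < m j) (hmono : StrictMono m)
    (hinf : Tendsto (fun j => (m j : ℝ)) atTop atTop)
    (hratio : Tendsto (fun j => (m (j + 1) : ℝ) / (m j : ℝ)) atTop (nhds 1))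
    (a : ℕ → ℝ) (c : ℝ) (hc : 0 < c)
    (ha : Tendsto (fun j => (m j : ℝ) * a j) atTop (nhds c)) :
    ∃ φ : ℕ → ℕ, StrictMono φ ∧
      (StrictAnti fun i => a (φ i)) ∧
      Tendsto (fun i => (m (φ (i + 1)) : ℝ) / (m (φ i) : ℝ)) atTop (nhds 1) ∧
      Tendsto (fun i => a (φ i) / a (φ (i + 1))) atTop (nhds 1) := by
  have hm : ∀ j, (0 : ℝ) < m j := fun j => by exact_mod_cast hpos j
  have ha0 : Tendsto a atTop (nhds 0) := by
    refine (ha.div_atTop hinf).congr fun j => ?_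
    field_simp [(hm j).ne']
  obtain ⟨J, hJ⟩ := eventually_atTop.1 (ha.eventually_const_lt hc)
  have hapos : ∀ j, J ≤ j → 0 < a j := fun j hj => (mul_pos_iff_of_pos_left (hm j)).1 (hJ j hj)
  choose! p hjp hap hdrop using fun j (hj : J ≤ j) => exists_first_drop ha0 (hapos j hj)
  let φ : ℕ → ℕ := fun i => (fun j => p j + 1)^[i] J
  have hsucc : ∀ i, φ (i + 1) = p (φ i) + 1 := fun i => Function.iterate_succ_apply' _ _ _
  have hφJ : ∀ i, J ≤ φ i := fun i => by
    induction i with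
    | zero => exact le_rfl
    | succ i ih =>
      rw [hsucc]
      exact (ih.trans (hjp _ ih)).trans (Nat.le_succ _)
  have hφ : StrictMono φ := strictMono_nat_of_lt_succ fun i => by
    rw [hsucc]
    exact Nat.lt_succ_of_le (hjp _ (hφJ i))
  have hφ_top : Tendsto φ atTop atTop := hφ.tendsto_atTop
  have hp_top : Tendsto (fun i => p (φ i)) atTop atTop :=
    tendsto_atTop_mono (fun i => hjp _ (hφJ i)) hφ_top
  have hbound : Tendsto (fun i => (m (p (φ i) + 1) : ℝ) / m (p (φ i)) *
      ((m (p (φ i)) * a (p (φ i))) / (m (φ i) * a (φ i)))) atTop (nhds 1) := by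
    have h := (hratio.comp hp_top).mul ((ha.comp hp_top).div (ha.comp hφ_top) hc.ne')
    rw [div_self hc.ne', mul_one] at h
    exact h
  have hmφ : Tendsto (fun i => (m (φ (i + 1)) : ℝ) / (m (φ i) : ℝ)) atTop (nhds 1) := by
    refine tendsto_of_tendsto_of_tendsto_of_le_of_le tendsto_const_nhds hbound
      (fun i => ?_) (fun i => ?_)
    · refine (one_le_div (hm _)).2 ?_
      exact_mod_cast hmono.monotone (hφ (Nat.lt_succ_self i)).le
    · have h1 := hapos _ (hφJ i)
      have h2 := hap _ (hφJ i)
      have hp := hm (p (φ i))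
      have hj := hm (φ i)
      have hk := hm (p (φ i) + 1)
      have heq : (m (p (φ i) + 1) : ℝ) / m (p (φ i)) *
          ((m (p (φ i)) * a (p (φ i))) / (m (φ i) * a (φ i))) =
          m (p (φ i) + 1) / m (φ i) * (a (p (φ i)) / a (φ i)) := by
        field_simp
      simp only [hsucc]
      rw [heq]
      exact le_mul_of_one_le_right (by positivity) ((one_le_div h1).2 h2)
  refine ⟨φ, hφ, strictAnti_nat_of_succ_lt fun i => ?_, hmφ, ?_⟩
  · rw [hsucc]
    exact hdrop _ (hφJ i)
  · have h := ((ha.comp hφ_top).div ((ha.comp hφ_top).comp (tendsto_add_atTop_nat 1))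
      hc.ne').mul hmφ
    rw [div_self hc.ne', mul_one] at h
    refine h.congr fun i => ?_
    have h1 := hapos _ (hφJ (i + 1))
    have hj := hm (φ i)
    have hk := hm (φ (i + 1))
    simp only [Function.comp_apply, Pi.div_apply]
    field_simp
end

section
/- Let α ∈ [0,1) and let m ≥ 4 be an integer with (m−2)(m−3)/(m−1)² > α. Then: (i) the function a ↦ μ(a) is continuous on [0,1] and satisfies 0 ≤ μ(a) ≤ 1; (ii) μ := μ(α) ≥ (m−2)(m−3)/(m−1)² > α; (iii) the set X := { z ∈ Δ_{m−1} : z₁ < 1 and (g_m(z) + α·z₂³)/(1 − z₁³) = μ } of maximizers is non-empty and compact, and there is ρ > 0 such that ‖z − e₁‖₂ ≥ ρ for all z ∈ X, where e₁ := (1,0,…,0); (iv) if z* ∈ X is chosen with (z*₂)³ maximal among elements of X, then q := (z*₁)³ satisfies 0 < q < 1 and R := (z*₂)³ satisfies R > 0. -/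
open Filter

/-- `g_m(z) = 6·Σ_{a<b<c} z_a z_b z_c`, the Lagrangian polynomial of the complete
`3`-graph on `m` vertices. -/
noncomputable def gPoly (m : ℕ) (z : Fin m → ℝ) : ℝ :=
  6 * ∑ e ∈ Finset.powersetCard 3 (Finset.univ : Finset (Fin m)), ∏ i ∈ e, z i

/-- `ψ_b(t) = max_{z∈Δ_{m−1}} ( g_m(z) + t·z₁³ + b·z₂³ )`. -/
noncomputable def psi (m : ℕ) (hm : 3 ≤ m) (b t : ℝ) : ℝ :=
  sSup { v : ℝ | ∃ z ∈ stdSimplex ℝ (Fin m),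
    v = gPoly m z + t * z ⟨0, by omega⟩ ^ 3 + b * z ⟨1, by omega⟩ ^ 3 }

/-- `μ(a) = max { (g_m(z) + a·z₂³)/(1 − z₁³) : z ∈ Δ_{m−1}, z₁ < 1 }`. -/
noncomputable def muFun (m : ℕ) (hm : 3 ≤ m) (a : ℝ) : ℝ :=
  sSup { v : ℝ | ∃ z ∈ stdSimplex ℝ (Fin m), z ⟨0, by omega⟩ < 1 ∧
    v = (gPoly m z + a * z ⟨1, by omega⟩ ^ 3) / (1 - z ⟨0, by omega⟩ ^ 3) }

/-- The set `X` of maximizers in the definition of `μ(a)`. -/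
def Xset (m : ℕ) (hm : 3 ≤ m) (a : ℝ) : Set (Fin m → ℝ) :=
  { z | z ∈ stdSimplex ℝ (Fin m) ∧ z ⟨0, by omega⟩ < 1 ∧
    (gPoly m z + a * z ⟨1, by omega⟩ ^ 3) / (1 - z ⟨0, by omega⟩ ^ 3) = muFun m hm a }

theorem gPoly_eq_power_sums (m : ℕ) (z : Fin m → ℝ) :
    gPoly m z = (∑ i, z i) ^ 3 - 3 * (∑ i, z i) * (∑ i, z i ^ 2) + 2 * ∑ i, z i ^ 3 := by
  have newton (k : ℕ) := congrArg (MvPolynomial.eval z)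
    (MvPolynomial.mul_esymm_eq_sum (Fin m) ℝ k)
  have h2 := newton 2
  have h3 := newton 3
  simp only [Finset.sum_filter, Finset.Nat.sum_antidiagonal_eq_sum_range_succ_mk,
    Finset.sum_range_succ, Finset.sum_range_zero, MvPolynomial.psum] at h2 h3
  simp at h2 h3
  have h0 : gPoly m z = 6 * MvPolynomial.eval z (MvPolynomial.esymm (Fin m) ℝ 3) := by
    simp [gPoly, MvPolynomial.esymm]
  rw [h0]
  linear_combination 2 * h3 + (∑ i, z i) * h2

theorem apply_le_one_of_mem_stdSimplex {ι : Type*} [Fintype ι] {z : ι → ℝ}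
    (hz : z ∈ stdSimplex ℝ ι) (i : ι) : z i ≤ 1 :=
  hz.2 ▸ Finset.single_le_sum (fun k _ => hz.1 k) (Finset.mem_univ i)

theorem add_le_one_of_mem_stdSimplex {ι : Type*} [Fintype ι] {z : ι → ℝ}
    (hz : z ∈ stdSimplex ℝ ι) {i j : ι} (hij : i ≠ j) : z i + z j ≤ 1 :=
  hz.2 ▸ Finset.add_le_sum (fun k _ => hz.1 k) (Finset.mem_univ i) (Finset.mem_univ j) hij

theorem gPoly_le {m : ℕ} {z : Fin m → ℝ} (hz : z ∈ stdSimplex ℝ (Fin m)) (i : Fin m) :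
    gPoly m z ≤ (1 - z i) ^ 2 * (1 + 2 * z i) := by
  rw [gPoly_eq_power_sums, hz.2]
  have hle (j : Fin m) : 0 ≤ 3 * z j ^ 2 - 2 * z j ^ 3 := by
    have h1 := apply_le_one_of_mem_stdSimplex hz j
    nlinarith [sq_nonneg (z j)]
  have := Finset.single_le_sum (f := fun j => 3 * z j ^ 2 - 2 * z j ^ 3)
    (fun k _ => hle k) (Finset.mem_univ i)
  rw [Finset.sum_sub_distrib, ← Finset.mul_sum, ← Finset.mul_sum] at this
  linarith

theorem gPoly_add_cubes_le {m : ℕ} {z : Fin m → ℝ} (hz : z ∈ stdSimplex ℝ (Fin m))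
    {i j : Fin m} (hij : i ≠ j) : gPoly m z + z i ^ 3 + z j ^ 3 ≤ 1 := by
  rw [gPoly_eq_power_sums, hz.2]
  have h1 : ∑ i, z i ^ 3 ≤ ∑ i, z i ^ 2 := Finset.sum_le_sum fun k _ =>
    pow_le_pow_of_le_one (hz.1 k) (apply_le_one_of_mem_stdSimplex hz k) (by norm_num)
  have h2 := Finset.add_le_sum (f := fun k => z k ^ 3) (fun k _ => pow_nonneg (hz.1 k) 3)
    (Finset.mem_univ i) (Finset.mem_univ j) hij
  linarith

theorem gPoly_nonneg {m : ℕ} {z : Fin m → ℝ} (hz : ∀ i, 0 ≤ z i) : 0 ≤ gPoly m z :=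
  mul_nonneg (by norm_num) (Finset.sum_nonneg fun _ _ => Finset.prod_nonneg fun i _ => hz i)

theorem gPoly_comp_perm (m : ℕ) (z : Fin m → ℝ) (σ : Equiv.Perm (Fin m)) :
    gPoly m (z ∘ σ) = gPoly m z := by
  simp only [gPoly_eq_power_sums, Function.comp_apply]
  rw [Equiv.sum_comp σ z, Equiv.sum_comp σ (fun i => z i ^ 2), Equiv.sum_comp σ (fun i => z i ^ 3)]

theorem continuous_gPoly (m : ℕ) : Continuous (gPoly m) := by
  unfold gPoly
  fun_prop

theorem comp_perm_mem_stdSimplex {ι : Type*} [Fintype ι] {z : ι → ℝ}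
    (hz : z ∈ stdSimplex ℝ ι) (σ : Equiv.Perm ι) : z ∘ σ ∈ stdSimplex ℝ ι :=
  ⟨fun i => hz.1 (σ i), (Equiv.sum_comp σ z).trans hz.2⟩

/-- The barycentre of the facet of the simplex opposite to the vertex `i`. -/
theorem exists_facet_barycentre {m : ℕ} (hm : 2 ≤ m) (i : Fin m) :
    ∃ z ∈ stdSimplex ℝ (Fin m), z i = 0 ∧
      gPoly m z = ((m : ℝ) - 2) * ((m : ℝ) - 3) / ((m : ℝ) - 1) ^ 2 := by
  have hm' : (2 : ℝ) ≤ m := by exact_mod_cast hm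
  have hpos : (0 : ℝ) < m - 1 := by linarith
  have hsum (c : ℝ) : ∑ k : Fin m, (if k = i then 0 else c) = (m - 1) * c := by
    rw [Finset.sum_ite, Finset.sum_const_zero, zero_add, Finset.sum_const,
      Finset.filter_ne', Finset.card_erase_of_mem (Finset.mem_univ i), Finset.card_univ,
      Fintype.card_fin, nsmul_eq_mul, Nat.cast_sub (by omega), Nat.cast_one]
  refine ⟨fun k => if k = i then 0 else ((m : ℝ) - 1)⁻¹, ⟨fun k => ?_, ?_⟩, by simp, ?_⟩
  · dsimp only
    split_ifs
    · exact le_rfl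
    · positivity
  · rw [hsum, mul_inv_cancel₀ hpos.ne']
  · simp only [gPoly_eq_power_sums, ite_pow, ne_eq, OfNat.ofNat_ne_zero, not_false_eq_true,
      zero_pow, hsum]
    field_simp
    ring

theorem cube_lt_one {x : ℝ} (h0 : 0 ≤ x) (h1 : x < 1) : x ^ 3 < 1 :=
  pow_lt_one₀ h0 h1 (by norm_num)

theorem ratio_le_one {m : ℕ} {z : Fin m → ℝ} (hz : z ∈ stdSimplex ℝ (Fin m)) {i j : Fin m}
    (hij : i ≠ j) (hi : z i < 1) {a : ℝ} (ha : a ≤ 1) :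
    (gPoly m z + a * z j ^ 3) / (1 - z i ^ 3) ≤ 1 := by
  rw [div_le_one (sub_pos.2 (cube_lt_one (hz.1 i) hi))]
  have := gPoly_add_cubes_le hz hij
  nlinarith [pow_nonneg (hz.1 j) 3]

theorem ratio_nonneg {m : ℕ} {z : Fin m → ℝ} (hz : z ∈ stdSimplex ℝ (Fin m)) (i j : Fin m)
    {a : ℝ} (ha : 0 ≤ a) : 0 ≤ (gPoly m z + a * z j ^ 3) / (1 - z i ^ 3) :=
  div_nonneg (add_nonneg (gPoly_nonneg hz.1) (mul_nonneg ha (pow_nonneg (hz.1 j) 3)))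
    (sub_nonneg.2 (pow_le_one₀ (hz.1 i) (apply_le_one_of_mem_stdSimplex hz i)))

theorem ratio_le {m : ℕ} {z : Fin m → ℝ} (hz : z ∈ stdSimplex ℝ (Fin m)) {i j : Fin m}
    (hij : i ≠ j) (hi : z i < 1) {a : ℝ} (ha : a ≤ 1) :
    (gPoly m z + a * z j ^ 3) / (1 - z i ^ 3) ≤ 3 * (1 - z i) := by
  have h0 := hz.1 i
  rw [div_le_iff₀ (sub_pos.2 (cube_lt_one h0 hi))]
  have h1 := gPoly_le hz i
  have h2 : z j ^ 3 ≤ (1 - z i) ^ 3 :=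
    pow_le_pow_left₀ (hz.1 j) (by linarith [add_le_one_of_mem_stdSimplex hz hij]) 3
  have h3 : a * z j ^ 3 ≤ (1 - z i) ^ 3 := by nlinarith [pow_nonneg (hz.1 j) 3]
  have h4 : 0 ≤ (1 - z i) ^ 2 * (1 + 2 * z i + 3 * z i ^ 2) := by positivity
  linear_combination h1 + h3 + h4

theorem ratio_sub_le {m : ℕ} {z : Fin m → ℝ} (hz : z ∈ stdSimplex ℝ (Fin m)) {i j : Fin m}
    (hij : i ≠ j) (hi : z i < 1) (a b : ℝ) :
    (gPoly m z + a * z j ^ 3) / (1 - z i ^ 3) ≤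
      (gPoly m z + b * z j ^ 3) / (1 - z i ^ 3) + |a - b| := by
  have hpos := sub_pos.2 (cube_lt_one (hz.1 i) hi)
  rw [div_add' _ _ _ hpos.ne', div_le_div_iff_of_pos_right hpos]
  have h1 : z j ^ 3 ≤ 1 - z i ^ 3 := by
    linarith [gPoly_add_cubes_le hz hij, gPoly_nonneg hz.1]
  have h2 : (a - b) * z j ^ 3 ≤ |a - b| * (1 - z i ^ 3) :=
    mul_le_mul (le_abs_self _) h1 (pow_nonneg (hz.1 j) 3) (abs_nonneg _)
  linarith

theorem ratio_le_muFun {m : ℕ} (hm : 3 ≤ m) {a : ℝ} (ha : a ≤ 1) {z : Fin m → ℝ}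
    (hz : z ∈ stdSimplex ℝ (Fin m)) (h0 : z ⟨0, by omega⟩ < 1) :
    (gPoly m z + a * z ⟨1, by omega⟩ ^ 3) / (1 - z ⟨0, by omega⟩ ^ 3) ≤ muFun m hm a := by
  refine le_csSup ⟨1, ?_⟩ ⟨z, hz, h0, rfl⟩
  rintro _ ⟨w, hw, hw0, rfl⟩
  exact ratio_le_one hw (by simp) hw0 ha

theorem muFun_le {m : ℕ} (hm : 3 ≤ m) {a c : ℝ}
    (h : ∀ z ∈ stdSimplex ℝ (Fin m), z ⟨0, by omega⟩ < 1 →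
      (gPoly m z + a * z ⟨1, by omega⟩ ^ 3) / (1 - z ⟨0, by omega⟩ ^ 3) ≤ c) :
    muFun m hm a ≤ c := by
  obtain ⟨z, hz, hz0, -⟩ := exists_facet_barycentre (by omega : 2 ≤ m) ⟨0, by omega⟩
  refine csSup_le ⟨_, z, hz, hz0.trans_lt one_pos, rfl⟩ ?_
  rintro _ ⟨w, hw, hw0, rfl⟩
  exact h w hw hw0

theorem muFun_le_add_abs {m : ℕ} (hm : 3 ≤ m) (a : ℝ) {b : ℝ} (hb : b ≤ 1) :
    muFun m hm a ≤ muFun m hm b + |a - b| :=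
  muFun_le hm fun z hz h0 => (ratio_sub_le hz (by simp) h0 a b).trans
    (by gcongr; exact ratio_le_muFun hm hb hz h0)

theorem continuousOn_muFun {m : ℕ} (hm : 3 ≤ m) : ContinuousOn (muFun m hm) (Set.Iic 1) := by
  refine (LipschitzOnWith.of_le_add fun a ha b hb => ?_ : LipschitzOnWith 1 _ _).continuousOn
  exact muFun_le_add_abs hm a hb

theorem facet_value_le_muFun {m : ℕ} (hm : 3 ≤ m) {a : ℝ} (ha : a ∈ Set.Icc (0 : ℝ) 1) :
    ((m : ℝ) - 2) * ((m : ℝ) - 3) / ((m : ℝ) - 1) ^ 2 ≤ muFun m hm a := by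
  obtain ⟨z, hz, hz0, hg⟩ := exists_facet_barycentre (by omega : 2 ≤ m) ⟨0, by omega⟩
  have h := ratio_le_muFun hm ha.2 hz (hz0.trans_lt one_pos)
  rw [hz0, hg] at h
  have := mul_nonneg ha.1 (pow_nonneg (hz.1 ⟨1, by omega⟩) 3)
  norm_num at h
  linarith

theorem muFun_mem_Icc {m : ℕ} (hm : 3 ≤ m) {a : ℝ} (ha : a ∈ Set.Icc (0 : ℝ) 1) :
    muFun m hm a ∈ Set.Icc (0 : ℝ) 1 := by
  refine ⟨le_trans ?_ (facet_value_le_muFun hm ha),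
    muFun_le hm fun z hz h0 => ratio_le_one hz (by simp) h0 ha.2⟩
  have : (3 : ℝ) ≤ m := by exact_mod_cast hm
  exact div_nonneg (mul_nonneg (by linarith) (by linarith)) (sq_nonneg _)

theorem muFun_le_of_mem_Xset {m : ℕ} (hm : 3 ≤ m) {a : ℝ} (ha : a ≤ 1) {z : Fin m → ℝ}
    (hz : z ∈ Xset m hm a) : muFun m hm a ≤ 3 * (1 - z ⟨0, by omega⟩) :=
  hz.2.2 ▸ ratio_le hz.1 (by simp) hz.2.1 ha

/-- The cubic form whose maximum over the simplex is `μ(a)`. -/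
theorem gPoly_add_muFun_mul_le {m : ℕ} (hm : 3 ≤ m) {a : ℝ} (ha : a ≤ 1) {z : Fin m → ℝ}
    (hz : z ∈ stdSimplex ℝ (Fin m)) :
    gPoly m z + a * z ⟨1, by omega⟩ ^ 3 + muFun m hm a * z ⟨0, by omega⟩ ^ 3 ≤
      muFun m hm a := by
  rcases (apply_le_one_of_mem_stdSimplex hz ⟨0, by omega⟩).lt_or_eq with h0 | h0
  · have := ratio_le_muFun hm ha hz h0
    rw [div_le_iff₀ (sub_pos.2 (cube_lt_one (hz.1 _) h0))] at this
    linarith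
  · have hne : (⟨0, by omega⟩ : Fin m) ≠ ⟨1, by omega⟩ := by simp
    have h1 : z ⟨1, by omega⟩ = 0 :=
      le_antisymm (by linarith [add_le_one_of_mem_stdSimplex hz hne]) (hz.1 _)
    have := gPoly_le hz ⟨0, by omega⟩
    rw [h0] at this ⊢
    rw [h1]
    linarith

theorem mem_Xset_iff {m : ℕ} (hm : 3 ≤ m) {a : ℝ} {z : Fin m → ℝ}
    (hz : z ∈ stdSimplex ℝ (Fin m)) (h0 : z ⟨0, by omega⟩ < 1) :
    z ∈ Xset m hm a ↔
      gPoly m z + a * z ⟨1, by omega⟩ ^ 3 + muFun m hm a * z ⟨0, by omega⟩ ^ 3 =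
        muFun m hm a := by
  have hpos := sub_pos.2 (cube_lt_one (hz.1 _) h0)
  have h : z ∈ Xset m hm a ↔
      (gPoly m z + a * z ⟨1, by omega⟩ ^ 3) / (1 - z ⟨0, by omega⟩ ^ 3) = muFun m hm a :=
    ⟨fun h => h.2.2, fun h => ⟨hz, h0, h⟩⟩
  rw [h, div_eq_iff hpos.ne']
  constructor <;> intro h <;> linarith

theorem isCompact_Xset {m : ℕ} (hm : 3 ≤ m) {a : ℝ} (ha : a ≤ 1) (hpos : 0 < muFun m hm a) :
    IsCompact (Xset m hm a) := by
  have heq : Xset m hm a = stdSimplex ℝ (Fin m) ∩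
      ({z | muFun m hm a ≤ 3 * (1 - z ⟨0, by omega⟩)} ∩
        {z | gPoly m z + a * z ⟨1, by omega⟩ ^ 3 + muFun m hm a * z ⟨0, by omega⟩ ^ 3 =
          muFun m hm a}) := by
    ext z
    constructor
    · intro hz
      exact ⟨hz.1, muFun_le_of_mem_Xset hm ha hz, (mem_Xset_iff hm hz.1 hz.2.1).1 hz⟩
    · rintro ⟨hz, hle, h⟩
      exact (mem_Xset_iff hm hz (by linarith [hle.out])).2 h
  rw [heq]
  have hg := continuous_gPoly m
  exact (isCompact_stdSimplex ℝ (Fin m)).inter_right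
    ((isClosed_le (by fun_prop) (by fun_prop)).inter (isClosed_eq (by fun_prop) (by fun_prop)))

theorem Xset_nonempty {m : ℕ} (hm4 : 4 ≤ m) (hm : 3 ≤ m) {a : ℝ} (ha : a ∈ Set.Icc (0 : ℝ) 1) :
    (Xset m hm a).Nonempty := by
  set c : ℝ := ((m : ℝ) - 2) * ((m : ℝ) - 3) / ((m : ℝ) - 1) ^ 2
  have hm' : (4 : ℝ) ≤ m := by exact_mod_cast hm4
  have hcpos : 0 < c :=
    div_pos (mul_pos (by linarith) (by linarith)) (pow_pos (by linarith) 2)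
  have hclt : c ≤ 1 := (facet_value_le_muFun hm ha).trans (muFun_mem_Icc hm ha).2
  obtain ⟨w, hw, hw0, hg⟩ := exists_facet_barycentre (by omega : 2 ≤ m) ⟨0, by omega⟩
  have hwc : c ≤ (gPoly m w + a * w ⟨1, by omega⟩ ^ 3) / (1 - w ⟨0, by omega⟩ ^ 3) := by
    have := mul_nonneg ha.1 (pow_nonneg (hw.1 ⟨1, by omega⟩) 3)
    rw [hw0, hg]
    norm_num
    linarith
  have hK : IsCompact (stdSimplex ℝ (Fin m) ∩ {z | c ≤ 3 * (1 - z ⟨0, by omega⟩)}) :=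
    (isCompact_stdSimplex ℝ (Fin m)).inter_right (isClosed_le (by fun_prop) (by fun_prop))
  have hcont : ContinuousOn (fun z : Fin m → ℝ =>
      (gPoly m z + a * z ⟨1, by omega⟩ ^ 3) / (1 - z ⟨0, by omega⟩ ^ 3))
      (stdSimplex ℝ (Fin m) ∩ {z | c ≤ 3 * (1 - z ⟨0, by omega⟩)}) := by
    have hg := continuous_gPoly m
    refine ContinuousOn.div (by fun_prop) (by fun_prop) fun z hz => ?_
    exact (sub_pos.2 (cube_lt_one (hz.1.1 _) (by linarith [hz.2.out]))).ne'
  have hwK : w ∈ stdSimplex ℝ (Fin m) ∩ {z | c ≤ 3 * (1 - z ⟨0, by omega⟩)} :=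
    ⟨hw, by rw [Set.mem_ofPred_eq, hw0]; linarith⟩
  obtain ⟨z, hz, hmax⟩ := hK.exists_isMaxOn ⟨w, hwK⟩ hcont
  have hz0 : z ⟨0, by omega⟩ < 1 := by linarith [hz.2.out]
  refine ⟨z, hz.1, hz0, le_antisymm (ratio_le_muFun hm ha.2 hz.1 hz0)
    (muFun_le hm fun y hy hy0 => ?_)⟩
  by_cases hyc : c ≤ 3 * (1 - y ⟨0, by omega⟩)
  · exact hmax ⟨hy, hyc⟩
  · exact (ratio_le hy (by simp) hy0 ha.2).trans
      ((not_le.1 hyc).le.trans (hwc.trans (hmax hwK)))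

theorem pos_zero_of_mem_Xset {m : ℕ} (hm : 3 ≤ m) {a : ℝ} (ha : a ∈ Set.Icc (0 : ℝ) 1)
    (hlt : a < muFun m hm a) {z : Fin m → ℝ} (hz : z ∈ Xset m hm a) :
    0 < z ⟨0, by omega⟩ := by
  refine (hz.1.1 _).lt_of_ne' fun h0 => ?_
  have hval := (mem_Xset_iff hm hz.1 hz.2.1).1 hz
  have key (j : Fin m) : z j = 0 := by
    by_contra hj
    have hpos : 0 < z j ^ 3 := pow_pos ((hz.1.1 j).lt_of_ne' hj) 3
    have h := gPoly_add_muFun_mul_le hm ha.2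
      (comp_perm_mem_stdSimplex hz.1 (Equiv.swap ⟨0, by omega⟩ j))
    rw [gPoly_comp_perm, Function.comp_apply, Function.comp_apply, Equiv.swap_apply_left] at h
    rw [h0] at hval
    by_cases hj1 : j = ⟨1, by omega⟩
    · subst hj1
      rw [Equiv.swap_apply_right, h0] at h
      nlinarith
    · rw [Equiv.swap_apply_of_ne_of_ne (by simp) (Ne.symm hj1)] at h
      nlinarith [ha.1]
  have := hz.1.2
  simp [key] at this

theorem pos_one_of_isMax {m : ℕ} (hm : 3 ≤ m) {a : ℝ} (ha : a ∈ Set.Icc (0 : ℝ) 1)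
    {z : Fin m → ℝ} (hz : z ∈ Xset m hm a)
    (hmax : ∀ w ∈ Xset m hm a, w ⟨1, by omega⟩ ^ 3 ≤ z ⟨1, by omega⟩ ^ 3) :
    0 < z ⟨1, by omega⟩ := by
  refine (hz.1.1 _).lt_of_ne' fun h1 => ?_
  have hval := (mem_Xset_iff hm hz.1 hz.2.1).1 hz
  have key (j : Fin m) (hj0 : j ≠ ⟨0, by omega⟩) : z j = 0 := by
    by_contra hj
    have hpos : 0 < z j ^ 3 := pow_pos ((hz.1.1 j).lt_of_ne' hj) 3
    have hmem := comp_perm_mem_stdSimplex hz.1 (Equiv.swap ⟨1, by omega⟩ j)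
    have hs0 : (z ∘ Equiv.swap ⟨1, by omega⟩ j) ⟨0, by omega⟩ = z ⟨0, by omega⟩ := by
      rw [Function.comp_apply, Equiv.swap_apply_of_ne_of_ne (by simp) hj0.symm]
    have hs1 : (z ∘ Equiv.swap ⟨1, by omega⟩ j) ⟨1, by omega⟩ = z j := by
      rw [Function.comp_apply, Equiv.swap_apply_left]
    have hX : z ∘ Equiv.swap ⟨1, by omega⟩ j ∈ Xset m hm a := by
      rw [mem_Xset_iff hm hmem (hs0 ▸ hz.2.1)]
      refine le_antisymm (gPoly_add_muFun_mul_le hm ha.2 hmem) ?_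
      rw [gPoly_comp_perm, hs0, hs1]
      rw [h1] at hval
      nlinarith [mul_nonneg ha.1 hpos.le]
    have := hmax _ hX
    rw [hs1, h1] at this
    norm_num at this
    linarith
  have h := Finset.sum_eq_single_of_mem (f := z) ⟨0, by omega⟩ (Finset.mem_univ _)
    fun j _ hj => key j hj
  rw [hz.1.2] at h
  linarith [hz.2.1]

/-- Basic properties of `μ`: continuity and range on `[0,1]`; `μ := μ(α)` is at
least `λ(K_{m−1}) = (m−2)(m−3)/(m−1)² > α`; the maximizer set `X` is non-empty and
compact and stays at `ℓ²`-distance at least some `ρ > 0` from `e₁ = (1,0,…,0)`;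
and any `z* ∈ X` maximizing `z₂³` has `q := (z*₁)³ ∈ (0,1)` and `R := (z*₂)³ > 0`. -/
theorem mu_basic (m : ℕ) (hm : 3 ≤ m) (hm4 : 4 ≤ m) (α : ℝ)
    (hα : α ∈ Set.Ico (0 : ℝ) 1)
    (hgap : α < ((m : ℝ) - 2) * ((m : ℝ) - 3) / ((m : ℝ) - 1) ^ 2) :
    ContinuousOn (muFun m hm) (Set.Icc 0 1) ∧
    (∀ a ∈ Set.Icc (0 : ℝ) 1, muFun m hm a ∈ Set.Icc (0 : ℝ) 1) ∧
    ((m : ℝ) - 2) * ((m : ℝ) - 3) / ((m : ℝ) - 1) ^ 2 ≤ muFun m hm α ∧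
    α < muFun m hm α ∧
    (Xset m hm α).Nonempty ∧ IsCompact (Xset m hm α) ∧
    (∃ ρ > (0 : ℝ), ∀ z ∈ Xset m hm α,
      ρ ≤ Real.sqrt (∑ i, (z i - (if i = (⟨0, by omega⟩ : Fin m) then 1 else 0)) ^ 2)) ∧
    (∀ zs ∈ Xset m hm α,
      (∀ z ∈ Xset m hm α, z ⟨1, by omega⟩ ^ 3 ≤ zs ⟨1, by omega⟩ ^ 3) →
      0 < zs ⟨0, by omega⟩ ^ 3 ∧ zs ⟨0, by omega⟩ ^ 3 < 1 ∧ 0 < zs ⟨1, by omega⟩ ^ 3) := by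
  have hα' : α ∈ Set.Icc (0 : ℝ) 1 := Set.Ico_subset_Icc_self hα
  have hle := facet_value_le_muFun hm hα'
  have hlt := hgap.trans_le hle
  have hpos := hα.1.trans_lt hlt
  refine ⟨(continuousOn_muFun hm).mono Set.Icc_subset_Iic_self, fun a ha => muFun_mem_Icc hm ha,
    hle, hlt, Xset_nonempty hm4 hm hα', isCompact_Xset hm hα.2.le hpos,
    ⟨muFun m hm α / 3, by positivity, fun z hz => ?_⟩, fun zs hzs hmax =>
      ⟨pow_pos (pos_zero_of_mem_Xset hm hα' hlt hzs) 3, cube_lt_one (hzs.1.1 _) hzs.2.1,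
        pow_pos (pos_one_of_isMax hm hα' hzs hmax) 3⟩⟩
  have h := muFun_le_of_mem_Xset hm hα.2.le hz
  apply Real.le_sqrt_of_sq_le
  have hsingle := Finset.single_le_sum
    (f := fun i => (z i - (if i = (⟨0, by omega⟩ : Fin m) then 1 else 0)) ^ 2)
    (fun i _ => sq_nonneg _) (Finset.mem_univ ⟨0, by omega⟩)
  refine le_trans ?_ hsingle
  simp only [if_true]
  nlinarith
end

section
/- Let r ≥ 3 be an integer and suppose that Π^{(r)}_∞ contains a non-degenerate interval, i.e., [a,b] ⊆ Π^{(r)}_∞ for some reals a < b. Then there exists δ > 0 such that [1 − δ, 1] ⊆ Π^{(r)}_∞. -/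
open Filter

/-- A finite `r`-graph: a collection of `r`-element subsets (edges) of a finite
vertex set, which we take to be `Fin n`. -/
structure HGraph (r : ℕ) where
  n : ℕ
  edges : Finset (Finset (Fin n))
  card_eq : ∀ e ∈ edges, e.card = r

/-- `H` embeds into `G` as a subgraph (via an injective map on vertices sending
edges to edges). -/
def HGraph.Embeds {r : ℕ} (H G : HGraph r) : Prop :=
  ∃ f : Fin H.n → Fin G.n, Function.Injective f ∧ ∀ e ∈ H.edges, e.image f ∈ G.edges

/-- `G` is `F`-free: no member of the family `F` embeds into `G`. -/
def IsFree {r : ℕ} (F : Set (HGraph r)) (G : HGraph r) : Prop :=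
  ∀ H ∈ F, ¬ H.Embeds G

/-- `ex(n, F)`: the maximum number of edges of an `F`-free `r`-graph on `n` vertices. -/
noncomputable def exNum (r : ℕ) (F : Set (HGraph r)) (n : ℕ) : ℕ :=
  sSup { m : ℕ | ∃ G : HGraph r, G.n = n ∧ IsFree F G ∧ G.edges.card = m }

/-- The Turán density of the family `F` is `x`. -/
def HasTuranDensity (r : ℕ) (F : Set (HGraph r)) (x : ℝ) : Prop :=
  Tendsto (fun n => (exNum r F n : ℝ) / (n.choose r : ℝ)) atTop (nhds x)

/-- `Π^{(r)}_∞`: the set of Turán densities of (possibly infinite) families of `r`-graphs. -/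
def PiInf (r : ℕ) : Set ℝ := { x | ∃ F : Set (HGraph r), HasTuranDensity r F x }

/-- No copy of a member of `F` lies inside `S`, or no edge of `E` lies inside `S`. -/
def PartFree {r : ℕ} (F : Set (HGraph r)) {α : Type*} [DecidableEq α]
    (E : Finset (Finset α)) (S : Finset α) : Prop :=
  (∀ H ∈ F, ¬ ∃ f : Fin H.n → α, Function.Injective f ∧ (∀ v, f v ∈ S) ∧
    ∀ e ∈ H.edges, e.image f ∈ E) ∨ ∀ e ∈ E, ¬ e ⊆ S

/-- The vertices of `G` can be coloured with `m` colours so that every colour class is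
`F`-free or spans no edge. -/
def PartitionFree {r : ℕ} (F : Set (HGraph r)) (m : ℕ) (G : HGraph r) : Prop :=
  ∃ c : Fin G.n → Fin m, ∀ i, PartFree F G.edges (Finset.univ.filter fun v => c v = i)

/-- The family of `r`-graphs that are not `PartitionFree`. -/
def partitionFamily {r : ℕ} (F : Set (HGraph r)) (m : ℕ) : Set (HGraph r) :=
  {H | ¬ PartitionFree F m H}

lemma PartFree.comap {r : ℕ} {F : Set (HGraph r)} {α β : Type*} [DecidableEq α] [DecidableEq β]
    {E : Finset (Finset α)} {S : Finset α} {E' : Finset (Finset β)} {S' : Finset β}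
    (h : PartFree F E S) (g : β → α) (hg : Function.Injective g) (hS : ∀ v ∈ S', g v ∈ S)
    (hE : ∀ e ∈ E', e ⊆ S' → e.image g ∈ E) : PartFree F E' S' := by
  rcases h with h | h
  · by_cases h0 : ∀ e ∈ E', ¬ e ⊆ S'
    · exact Or.inr h0
    · refine Or.inl ?_
      rintro H hH ⟨f, hf, hfS, hfE⟩
      refine h H hH ⟨g ∘ f, hg.comp hf, fun v => hS _ (hfS v), fun e he => ?_⟩
      rw [← Finset.image_image]
      refine hE _ (hfE e he) ?_
      intro x hx
      obtain ⟨v, -, rfl⟩ := Finset.mem_image.1 hx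
      exact hfS v
  · refine Or.inr fun e he hes => h _ (hE e he hes) ?_
    intro x hx
    obtain ⟨v, hv, rfl⟩ := Finset.mem_image.1 hx
    exact hS v (hes hv)

lemma PartitionFree.of_embeds {r : ℕ} {F : Set (HGraph r)} {m : ℕ} {H G : HGraph r}
    (hG : PartitionFree F m G) (h : H.Embeds G) : PartitionFree F m H := by
  obtain ⟨c, hc⟩ := hG
  obtain ⟨g, hg, hgE⟩ := h
  exact ⟨c ∘ g, fun i => (hc i).comap g hg (by simp) fun e he _ => hgE e he⟩

lemma isFree_partitionFamily {r : ℕ} {F : Set (HGraph r)} {m : ℕ} {G : HGraph r} :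
    IsFree (partitionFamily F m) G ↔ PartitionFree F m G := by
  refine ⟨fun h => ?_, fun h H hH hHG => hH (h.of_embeds hHG)⟩
  by_contra hG
  exact h G hG ⟨id, Function.injective_id, by simp⟩

lemma card_edges_le_choose {r : ℕ} (G : HGraph r) : G.edges.card ≤ G.n.choose r := by
  have : G.edges ⊆ Finset.powersetCard r Finset.univ := fun e he => by
    simp [Finset.mem_powersetCard, G.card_eq e he]
  simpa using Finset.card_le_card this

lemma bddAbove_edges (r : ℕ) (F : Set (HGraph r)) (n : ℕ) :
    BddAbove {m : ℕ | ∃ G : HGraph r, G.n = n ∧ IsFree F G ∧ G.edges.card = m} := by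
  refine ⟨n.choose r, ?_⟩
  rintro m ⟨G, rfl, -, rfl⟩
  exact card_edges_le_choose G

lemma exNum_le_choose (r : ℕ) (F : Set (HGraph r)) (n : ℕ) : exNum r F n ≤ n.choose r := by
  refine csSup_le' ?_
  rintro m ⟨G, rfl, -, rfl⟩
  exact card_edges_le_choose G

lemma IsFree.card_edges_le_exNum {r : ℕ} {F : Set (HGraph r)} {G : HGraph r} (hG : IsFree F G) :
    G.edges.card ≤ exNum r F G.n :=
  le_csSup (bddAbove_edges r F G.n) ⟨G, rfl, hG, rfl⟩

lemma PartFree.card_le_exNum {r : ℕ} {F : Set (HGraph r)} {n : ℕ} {E : Finset (Finset (Fin n))}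
    {S : Finset (Fin n)} (h : PartFree F E S) (hE : ∀ e ∈ E, e.card = r) :
    (E.filter (· ⊆ S)).card ≤ exNum r F S.card := by
  rcases h with h | h
  · let ι := S.orderEmbOfFin rfl
    have hι : Set.range ι = S := S.range_orderEmbOfFin rfl
    let G : HGraph r :=
      { n := S.card
        edges := Finset.univ.filter fun e => e.image ι ∈ E
        card_eq := fun e he => by
          rw [← hE _ (Finset.mem_filter.1 he).2, Finset.card_image_of_injective _ ι.injective] }
    have hG : IsFree F G := by
      rintro H hH ⟨f, hf, hfE⟩
      refine h H hH ⟨ι ∘ f, ι.injective.comp hf, fun v => S.orderEmbOfFin_mem rfl _,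
        fun e he => ?_⟩
      rw [← Finset.image_image]
      exact (Finset.mem_filter.1 (hfE e he)).2
    refine le_trans ?_ hG.card_edges_le_exNum
    have : E.filter (· ⊆ S) ⊆ G.edges.image (fun e => e.image ι) := by
      intro e he
      obtain ⟨he, heS⟩ := Finset.mem_filter.1 he
      obtain ⟨e', rfl⟩ : ∃ e' : Finset (Fin S.card), e'.image ι = e := by
        refine ⟨Finset.univ.filter (ι · ∈ e), ?_⟩
        ext x
        simp only [Finset.mem_image, Finset.mem_filter, Finset.mem_univ, true_and]
        constructor
        · rintro ⟨a, ha, rfl⟩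
          exact ha
        · intro hx
          obtain ⟨a, rfl⟩ : x ∈ Set.range ι := by rw [hι]; exact heS hx
          exact ⟨a, hx, rfl⟩
      exact Finset.mem_image.2 ⟨e', Finset.mem_filter.2 ⟨Finset.mem_univ _, he⟩, rfl⟩
    exact (Finset.card_le_card this).trans Finset.card_image_le
  · rw [Finset.filter_false_of_mem h]
    simp

lemma exists_partFree_card_eq_exNum {r : ℕ} (F : Set (HGraph r)) {n : ℕ} (S : Finset (Fin n)) :
    ∃ E : Finset (Finset (Fin n)), E ⊆ Finset.powersetCard r S ∧ PartFree F E S ∧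
      E.card = exNum r F S.card := by
  rcases Set.eq_empty_or_nonempty
    {m : ℕ | ∃ G : HGraph r, G.n = S.card ∧ IsFree F G ∧ G.edges.card = m} with h | h
  · refine ⟨∅, by simp, Or.inr (by simp), ?_⟩
    simp only [exNum, h]
    simp
  · obtain ⟨G, hn, hG, hc⟩ := Nat.sSup_mem h (bddAbove_edges r F S.card)
    let ι := S.orderEmbOfFin hn.symm
    have hι : Set.range ι = S := S.range_orderEmbOfFin hn.symm
    have hinj : Function.Injective fun e : Finset (Fin G.n) => e.image ι :=
      Finset.image_injective ι.injective
    refine ⟨G.edges.image fun e => e.image ι, ?_, Or.inl ?_, ?_⟩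
    · intro e he
      obtain ⟨e, he', rfl⟩ := Finset.mem_image.1 he
      rw [Finset.mem_powersetCard, Finset.card_image_of_injective _ ι.injective]
      refine ⟨?_, G.card_eq e he'⟩
      intro x hx
      obtain ⟨v, -, rfl⟩ := Finset.mem_image.1 hx
      exact S.orderEmbOfFin_mem hn.symm v
    · rintro H hH ⟨f, hf, hfS, hfE⟩
      have : ∀ v, ∃ w, ι w = f v := fun v => by
        have : f v ∈ Set.range ι := by rw [hι]; exact hfS v
        exact this
      choose g hg using this
      have hfg : f = ι ∘ g := funext fun v => (hg v).symm
      refine hG H hH ⟨g, fun v w hvw => hf (by rw [← hg, ← hg, hvw]), fun e he => ?_⟩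
      have := hfE e he
      rw [hfg, ← Finset.image_image] at this
      obtain ⟨e', he', h'⟩ := Finset.mem_image.1 this
      rwa [← hinj h']
    · rw [Finset.card_image_of_injective _ hinj, hc]
      rfl

lemma pairwiseDisjoint_powersetCard_fibers {r : ℕ} (hr : 1 ≤ r) {n m : ℕ} (c : Fin n → Fin m) :
    ((Finset.univ : Finset (Fin m)) : Set (Fin m)).PairwiseDisjoint
      fun i => Finset.powersetCard r (Finset.univ.filter fun v => c v = i) := by
  intro i _ j _ hij
  refine Finset.disjoint_left.2 fun e hi hj => hij ?_
  rw [Finset.mem_powersetCard] at hi hj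
  obtain ⟨v, hv⟩ : e.Nonempty := by
    rw [← Finset.card_pos]
    omega
  rw [← (Finset.mem_filter.1 (hi.1 hv)).2, (Finset.mem_filter.1 (hj.1 hv)).2]

/-- The number of edges missing from a maximum `F`-free `r`-graph on `n` vertices. -/
noncomputable def exDeficit (r : ℕ) (F : Set (HGraph r)) (n : ℕ) : ℕ :=
  n.choose r - exNum r F n

lemma exNum_add_exDeficit (r : ℕ) (F : Set (HGraph r)) (n : ℕ) :
    exNum r F n + exDeficit r F n = n.choose r :=
  Nat.add_sub_cancel' (exNum_le_choose r F n)

lemma exDeficit_partitionFamily_le {r : ℕ} (hr : 1 ≤ r) (F : Set (HGraph r)) {m n : ℕ}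
    (c : Fin n → Fin m) :
    exDeficit r (partitionFamily F m) n ≤
      ∑ i, exDeficit r F (Finset.univ.filter fun v => c v = i).card := by
  set S : Fin m → Finset (Fin n) := fun i => Finset.univ.filter fun v => c v = i with hS
  choose E hEs hEf hEc using fun i => exists_partFree_card_eq_exNum F (S i)
  have hdisj := pairwiseDisjoint_powersetCard_fibers hr c
  set P := Finset.powersetCard r (Finset.univ : Finset (Fin n)) with hP
  set M := Finset.univ.biUnion fun i => Finset.powersetCard r (S i) with hM
  have hMP : M ⊆ P := by
    rw [hM, Finset.biUnion_subset]
    exact fun i _ => Finset.powersetCard_mono (Finset.subset_univ _)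
  set U := Finset.univ.biUnion E with hU
  have hUM : U ⊆ M := Finset.biUnion_mono fun i _ => hEs i
  have hUc : U.card = ∑ i, exNum r F (S i).card := by
    rw [hU, Finset.card_biUnion (fun i hi j hj hij => (hdisj hi hj hij).mono (hEs i) (hEs j))]
    exact Finset.sum_congr rfl fun i _ => hEc i
  have hMc : M.card = ∑ i, (S i).card.choose r := by
    rw [hM, Finset.card_biUnion hdisj]
    exact Finset.sum_congr rfl fun i _ => Finset.card_powersetCard _ _
  have hPc : P.card = n.choose r := by simp [hP]
  let G : HGraph r :=
    { n := n
      edges := (P \ M) ∪ U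
      card_eq := fun e he => by
        have : e ∈ P := (Finset.union_subset Finset.sdiff_subset (hUM.trans hMP)) he
        exact (Finset.mem_powersetCard.1 this).2 }
  have hG : IsFree (partitionFamily F m) G := by
    rw [isFree_partitionFamily]
    refine ⟨c, fun i => (hEf i).comap id Function.injective_id (fun v hv => hv) ?_⟩
    intro e he hei
    rw [Finset.image_id]
    have hecard : e.card = r := G.card_eq e he
    have hei' : e ∈ Finset.powersetCard r (S i) := Finset.mem_powersetCard.2 ⟨hei, hecard⟩
    rcases Finset.mem_union.1 he with he | he
    · exact absurd (Finset.mem_biUnion.2 ⟨i, Finset.mem_univ _, hei'⟩) (Finset.mem_sdiff.1 he).2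
    · obtain ⟨j, -, hj⟩ := Finset.mem_biUnion.1 he
      by_cases hij : i = j
      · rwa [hij]
      · exact absurd (hEs j hj) (Finset.disjoint_left.1
          (hdisj (Finset.mem_coe.2 (Finset.mem_univ i)) (Finset.mem_coe.2 (Finset.mem_univ j)) hij)
          hei')
  have hle : (P \ M ∪ U).card ≤ exNum r (partitionFamily F m) n := hG.card_edges_le_exNum
  rw [Finset.card_union_of_disjoint (Finset.sdiff_disjoint.mono_right hUM), hUc] at hle
  have h1 := Finset.card_sdiff_add_card_eq_card hMP
  have h2 := exNum_add_exDeficit r (partitionFamily F m) n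
  have h3 : ∑ i, exNum r F (S i).card + ∑ i, exDeficit r F (S i).card =
      ∑ i, (S i).card.choose r := by
    rw [← Finset.sum_add_distrib]
    exact Finset.sum_congr rfl fun i _ => exNum_add_exDeficit r F _
  change _ ≤ ∑ i, exDeficit r F (S i).card
  omega

lemma exists_sum_exDeficit_le {r : ℕ} (hr : 1 ≤ r) (F : Set (HGraph r)) {m : ℕ} (hm : 1 ≤ m)
    (n : ℕ) : ∃ k : Fin m → ℕ, ∑ i, k i = n ∧
      ∑ i, exDeficit r F (k i) ≤ exDeficit r (partitionFamily F m) n := by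
  have hne : {k : ℕ | ∃ G : HGraph r, G.n = n ∧ IsFree (partitionFamily F m) G ∧
      G.edges.card = k}.Nonempty := by
    refine ⟨0, ⟨n, ∅, by simp⟩, rfl, ?_, by simp⟩
    rw [isFree_partitionFamily]
    exact ⟨fun _ => ⟨0, hm⟩, fun i => Or.inr (by simp)⟩
  obtain ⟨G, rfl, hG, hc⟩ := Nat.sSup_mem hne (bddAbove_edges _ _ _)
  change G.edges.card = exNum r (partitionFamily F m) G.n at hc
  obtain ⟨c, hcol⟩ := isFree_partitionFamily.1 hG
  set S : Fin m → Finset (Fin G.n) := fun i => Finset.univ.filter fun v => c v = i with hS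
  have hsum : ∑ i, (S i).card = G.n := by
    have := Finset.card_eq_sum_card_fiberwise (f := c) (s := Finset.univ) (t := Finset.univ)
      (fun _ _ => by simp)
    simpa using this.symm
  refine ⟨fun i => (S i).card, hsum, ?_⟩
  have hdisj := pairwiseDisjoint_powersetCard_fibers hr c
  set P := Finset.powersetCard r (Finset.univ : Finset (Fin G.n)) with hP
  set M := Finset.univ.biUnion fun i => Finset.powersetCard r (S i) with hM
  have hMP : M ⊆ P := by
    rw [hM, Finset.biUnion_subset]
    exact fun i _ => Finset.powersetCard_mono (Finset.subset_univ _)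
  have hMc : M.card = ∑ i, (S i).card.choose r := by
    rw [hM, Finset.card_biUnion hdisj]
    exact Finset.sum_congr rfl fun i _ => Finset.card_powersetCard _ _
  have hPc : P.card = G.n.choose r := by simp [hP]
  have hsub : G.edges ⊆ (P \ M) ∪ Finset.univ.biUnion fun i => G.edges.filter (· ⊆ S i) := by
    intro e he
    have hec := G.card_eq e he
    by_cases heM : e ∈ M
    · obtain ⟨i, -, hi⟩ := Finset.mem_biUnion.1 heM
      exact Finset.mem_union_right _ (Finset.mem_biUnion.2 ⟨i, Finset.mem_univ _,
        Finset.mem_filter.2 ⟨he, (Finset.mem_powersetCard.1 hi).1⟩⟩)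
    · exact Finset.mem_union_left _ (Finset.mem_sdiff.2
        ⟨Finset.mem_powersetCard.2 ⟨Finset.subset_univ _, hec⟩, heM⟩)
  have h0 : G.edges.card ≤ (P \ M).card + ∑ i, exNum r F (S i).card :=
    (Finset.card_le_card hsub).trans <| (Finset.card_union_le _ _).trans <|
      Nat.add_le_add_left (Finset.card_biUnion_le.trans
        (Finset.sum_le_sum fun i _ => (hcol i).card_le_exNum G.card_eq)) _
  have h1 := Finset.card_sdiff_add_card_eq_card hMP
  have h2 := exNum_add_exDeficit r (partitionFamily F m) G.n
  have h3 : ∑ i, exNum r F (S i).card + ∑ i, exDeficit r F (S i).card =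
      ∑ i, (S i).card.choose r := by
    rw [← Finset.sum_add_distrib]
    exact Finset.sum_congr rfl fun i _ => exNum_add_exDeficit r F _
  change ∑ i, exDeficit r F (S i).card ≤ _
  omega

lemma tendsto_choose_div_pow (r : ℕ) :
    Tendsto (fun n : ℕ => (n.choose r : ℝ) / (n : ℝ) ^ r) atTop (nhds (1 / r.factorial)) := by
  have h := (isEquivalent_choose r).symm
  have hz : ∀ᶠ n : ℕ in atTop, (n.choose r : ℝ) ≠ 0 := by
    filter_upwards [eventually_ge_atTop r] with n hn
    exact_mod_cast (Nat.choose_pos hn).ne'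
  rw [Asymptotics.isEquivalent_iff_tendsto_one hz] at h
  have hf : (r.factorial : ℝ) ≠ 0 := by exact_mod_cast r.factorial_ne_zero
  have h2 := (h.inv₀ one_ne_zero).mul_const (1 / (r.factorial : ℝ))
  rw [inv_one, one_mul] at h2
  refine h2.congr' ?_
  filter_upwards [eventually_gt_atTop 0] with n hn
  have : (n : ℝ) ≠ 0 := by positivity
  simp only [Pi.div_apply]
  field_simp

lemma hasTuranDensity_iff_tendsto_exDeficit {r : ℕ} {F : Set (HGraph r)} {x : ℝ} :
    HasTuranDensity r F x ↔
      Tendsto (fun n : ℕ => (exDeficit r F n : ℝ) / (n : ℝ) ^ r) atTop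
        (nhds ((1 - x) / r.factorial)) := by
  have hC := tendsto_choose_div_pow r
  have hf : (r.factorial : ℝ) ≠ 0 := by exact_mod_cast r.factorial_ne_zero
  have key : ∀ n, (exDeficit r F n : ℝ) = n.choose r - exNum r F n := fun n => by
    rw [← exNum_add_exDeficit r F n]
    push_cast
    ring
  have hpos : ∀ᶠ n : ℕ in atTop, (n.choose r : ℝ) ≠ 0 ∧ (n : ℝ) ≠ 0 := by
    filter_upwards [eventually_ge_atTop r, eventually_gt_atTop 0] with n hn hn0
    exact ⟨by exact_mod_cast (Nat.choose_pos hn).ne', by positivity⟩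
  constructor
  · intro h
    have h2 := (h.const_sub 1).mul hC
    rw [mul_one_div] at h2
    refine h2.congr' ?_
    filter_upwards [hpos] with n ⟨h1, h3⟩
    rw [key]
    field_simp
  · intro h
    have h2 := (h.div hC (one_div_ne_zero hf)).const_sub 1
    have hx : 1 - (1 - x) / (r.factorial : ℝ) / (1 / r.factorial) = x := by
      field_simp
      ring
    rw [hx] at h2
    refine h2.congr' ?_
    filter_upwards [hpos] with n ⟨h1, h3⟩
    simp only [Pi.div_apply, key]
    field_simp
    ring

lemma exists_balanced_colouring {m : ℕ} (hm : 1 ≤ m) (n : ℕ) :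
    ∃ c : Fin n → Fin m, ∀ i, n / m ≤ (Finset.univ.filter fun v => c v = i).card ∧
      (Finset.univ.filter fun v => c v = i).card ≤ n / m + 1 := by
  refine ⟨fun v => ⟨v % m, Nat.mod_lt _ hm⟩, fun i => ?_⟩
  have h := Nat.count_modEq_card n hm i
  have h2 : (Finset.univ.filter fun v : Fin n => (⟨v % m, Nat.mod_lt _ hm⟩ : Fin m) = i).card =
      n.count (· ≡ i [MOD m]) := by
    rw [Nat.count_eq_card_filter_range, ← Finset.card_map Fin.valEmbedding]
    congr 1
    ext v
    simp only [Finset.mem_map, Finset.mem_filter, Finset.mem_univ, true_and,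
      Fin.valEmbedding_apply, Finset.mem_range, Nat.ModEq, Nat.mod_eq_of_lt i.2, Fin.ext_iff]
    exact ⟨fun ⟨w, hw, hwv⟩ => hwv ▸ ⟨w.2, hw⟩, fun ⟨hv, hvi⟩ => ⟨⟨v, hv⟩, hvi, rfl⟩⟩
  rw [h2, h]
  split_ifs <;> omega

lemma exists_mul_pow_sub_le {d : ℕ → ℕ} {r : ℕ} {y ε : ℝ} (hε : 0 < ε)
    (hd : Tendsto (fun n : ℕ => (d n : ℝ) / (n : ℝ) ^ r) atTop (nhds y)) :
    ∃ K : ℝ, ∀ k : ℕ, (y - ε) * (k : ℝ) ^ r - K ≤ d k := by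
  obtain ⟨N, hN⟩ := eventually_atTop.1 (hd.eventually (lt_mem_nhds (sub_lt_self y hε)))
  refine ⟨|y - ε| * (N + 1 : ℝ) ^ r, fun k => ?_⟩
  rcases le_or_gt (N + 1) k with hk | hk
  · have h := hN k (by omega)
    rw [lt_div_iff₀ (by have : 0 < k := by omega
                        positivity)] at h
    have : 0 ≤ |y - ε| * (N + 1 : ℝ) ^ r := by positivity
    linarith
  · have h1 : (y - ε) * (k : ℝ) ^ r ≤ |y - ε| * (N + 1 : ℝ) ^ r := by
      refine mul_le_mul (le_abs_self _) ?_ (by positivity) (abs_nonneg _)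
      gcongr
      exact_mod_cast hk.le
    have : (0 : ℝ) ≤ d k := Nat.cast_nonneg _
    linarith

lemma tendsto_exDeficit_partitionFamily {r : ℕ} {F : Set (HGraph (r + 1))} {m : ℕ}
    (hm : 1 ≤ m) {y : ℝ}
    (hd : Tendsto (fun n : ℕ => (exDeficit (r + 1) F n : ℝ) / (n : ℝ) ^ (r + 1)) atTop
      (nhds y)) :
    Tendsto (fun n : ℕ => (exDeficit (r + 1) (partitionFamily F m) n : ℝ) / (n : ℝ) ^ (r + 1))
      atTop (nhds (y / (m : ℝ) ^ r)) := by
  have hm0 : (0 : ℝ) < m := by exact_mod_cast hm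
  have hy : 0 ≤ y := ge_of_tendsto' hd fun n => by positivity
  have hpow : Tendsto (fun n : ℕ => (n : ℝ) ^ (r + 1)) atTop atTop :=
    (tendsto_pow_atTop r.succ_ne_zero).comp tendsto_natCast_atTop_atTop
  refine tendsto_order.2 ⟨fun a ha => ?_, fun a ha => ?_⟩
  · obtain ⟨ε, hε, hεa⟩ : ∃ ε : ℝ, 0 < ε ∧ a < y / (m : ℝ) ^ r - ε * m := by
      refine ⟨(y / (m : ℝ) ^ r - a) / (2 * m), div_pos (sub_pos.2 ha) (by positivity), ?_⟩
      have : (y / (m : ℝ) ^ r - a) / (2 * m) * m = (y / (m : ℝ) ^ r - a) / 2 := by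
        field_simp
      linarith
    obtain ⟨K, hK⟩ := exists_mul_pow_sub_le hε hd
    have hlim : Tendsto (fun n : ℕ => y / (m : ℝ) ^ r - ε * m - m * K / (n : ℝ) ^ (r + 1)) atTop
        (nhds (y / (m : ℝ) ^ r - ε * m)) := by
      simpa using (hpow.const_div_atTop (m * K)).const_sub (y / (m : ℝ) ^ r - ε * m)
    filter_upwards [hlim.eventually (lt_mem_nhds hεa), eventually_gt_atTop 0] with n hn hn0
    refine hn.trans_le ?_
    have hnpos : (0 : ℝ) < (n : ℝ) ^ (r + 1) := by positivity
    obtain ⟨k, hk, hkD⟩ := exists_sum_exDeficit_le (Nat.le_add_left 1 r) F hm n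
    have h1 : ∑ i, ((y - ε) * (k i : ℝ) ^ (r + 1) - K) ≤
        (exDeficit (r + 1) (partitionFamily F m) n : ℝ) := by
      refine (Finset.sum_le_sum fun i _ => hK (k i)).trans ?_
      exact_mod_cast hkD
    have h2 : (n : ℝ) ^ (r + 1) / (m : ℝ) ^ r ≤ ∑ i, (k i : ℝ) ^ (r + 1) := by
      have := pow_sum_div_card_le_sum_pow (s := Finset.univ) (f := fun i => (k i : ℝ))
        (fun i _ => Nat.cast_nonneg _) r
      rwa [← Nat.cast_sum, hk, Finset.card_univ, Fintype.card_fin] at this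
    have h3 : ∑ i, (k i : ℝ) ^ (r + 1) ≤ m * (n : ℝ) ^ (r + 1) := by
      have : ∀ i ∈ Finset.univ, (k i : ℝ) ^ (r + 1) ≤ (n : ℝ) ^ (r + 1) := fun i hi => by
        gcongr
        rw [← hk]
        exact Finset.single_le_sum (fun _ _ => Nat.zero_le _) hi
      simpa using Finset.sum_le_sum this
    rw [Finset.sum_sub_distrib, ← Finset.mul_sum] at h1
    simp only [Finset.sum_const, Finset.card_univ, Fintype.card_fin, nsmul_eq_mul] at h1
    rw [le_div_iff₀ hnpos, sub_mul, sub_mul, div_mul_cancel₀ _ hnpos.ne']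
    have h4 := mul_le_mul_of_nonneg_left h2 hy
    have h5 := mul_le_mul_of_nonneg_left h3 hε.le
    have h6 : y / (m : ℝ) ^ r * (n : ℝ) ^ (r + 1) = y * ((n : ℝ) ^ (r + 1) / (m : ℝ) ^ r) := by
      ring
    rw [h6]
    linarith
  · choose c hc using exists_balanced_colouring hm
    let k : Fin m → ℕ → ℕ := fun i n => (Finset.univ.filter fun v => c n v = i).card
    have hkdiv : ∀ i, Tendsto (fun n => (k i n : ℝ) / n) atTop (nhds (1 / m)) := by
      intro i
      have hinv : Tendsto (fun n : ℕ => (1 : ℝ) / n) atTop (nhds 0) :=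
        tendsto_one_div_atTop_nhds_zero_nat
      refine tendsto_of_tendsto_of_tendsto_of_le_of_le' (g := fun n : ℕ => 1 / (m : ℝ) - 1 / n)
        (h := fun n : ℕ => 1 / (m : ℝ) + 1 / n) (by simpa using hinv.const_sub (1 / (m : ℝ)))
        (by simpa using hinv.const_add (1 / (m : ℝ))) ?_ ?_
      · filter_upwards [eventually_gt_atTop 0] with n hn
        have hn' : (0 : ℝ) < n := by exact_mod_cast hn
        rw [le_div_iff₀ hn', sub_mul, one_div_mul_cancel hn'.ne', one_div_mul_eq_div]
        have h1 : (n : ℝ) / m < (n / m : ℕ) + 1 := by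
          rw [div_lt_iff₀' hm0]
          exact_mod_cast Nat.lt_mul_div_succ n hm
        have h2 : ((n / m : ℕ) : ℝ) ≤ k i n := by exact_mod_cast (hc n i).1
        linarith
      · filter_upwards [eventually_gt_atTop 0] with n hn
        have hn' : (0 : ℝ) < n := by exact_mod_cast hn
        rw [div_le_iff₀ hn', add_mul, one_div_mul_cancel hn'.ne', one_div_mul_eq_div]
        have h1 : ((n / m : ℕ) : ℝ) ≤ (n : ℝ) / m := Nat.cast_div_le
        have h2 : (k i n : ℝ) ≤ (n / m : ℕ) + 1 := by exact_mod_cast (hc n i).2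
        linarith
    have hkatTop : ∀ i, Tendsto (k i) atTop atTop := fun i =>
      tendsto_atTop_mono (fun n => (hc n i).1) (Nat.tendsto_div_const_atTop (by omega))
    have hlim : Tendsto (fun n : ℕ => ∑ i, (exDeficit (r + 1) F (k i n) : ℝ) / (n : ℝ) ^ (r + 1))
        atTop (nhds (y / (m : ℝ) ^ r)) := by
      have hL : y / (m : ℝ) ^ r = ∑ _i : Fin m, y * (1 / (m : ℝ)) ^ (r + 1) := by
        simp only [Finset.sum_const, Finset.card_univ, Fintype.card_fin, nsmul_eq_mul, div_pow,
          one_pow]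
        field_simp
        ring
      rw [hL]
      refine tendsto_finsetSum _ fun i _ => ?_
      refine ((hd.comp (hkatTop i)).mul ((hkdiv i).pow (r + 1))).congr' ?_
      filter_upwards [eventually_gt_atTop 0, (hkatTop i).eventually_gt_atTop 0] with n hn hk
      rw [Function.comp_apply, div_pow]
      field_simp
    filter_upwards [hlim.eventually (gt_mem_nhds ha)] with n hn
    refine lt_of_le_of_lt ?_ hn
    rw [← Finset.sum_div]
    gcongr
    exact_mod_cast exDeficit_partitionFamily_le (Nat.le_add_left 1 r) F (c n)

/-- `Π^{(r)}_∞` is closed under the maps `x ↦ 1 - (1 - x) / m ^ (r - 1)`. -/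
lemma one_sub_div_pow_mem_piInf {r : ℕ} (hr : 1 ≤ r) {x : ℝ} (hx : x ∈ PiInf r) {m : ℕ}
    (hm : 1 ≤ m) : 1 - (1 - x) / (m : ℝ) ^ (r - 1) ∈ PiInf r := by
  obtain ⟨r, rfl⟩ := Nat.exists_eq_add_of_le' hr
  obtain ⟨F, hF⟩ := hx
  refine ⟨partitionFamily F m, ?_⟩
  rw [hasTuranDensity_iff_tendsto_exDeficit] at hF ⊢
  convert tendsto_exDeficit_partitionFamily hm hF using 2
  rw [Nat.add_sub_cancel, sub_sub_cancel, div_right_comm]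

lemma le_one_of_mem_piInf {r : ℕ} {x : ℝ} (hx : x ∈ PiInf r) : x ≤ 1 := by
  obtain ⟨F, hF⟩ := hx
  refine le_of_tendsto' hF fun n => div_le_one_of_le₀ ?_ (Nat.cast_nonneg _)
  exact_mod_cast exNum_le_choose r F n

lemma one_mem_piInf (r : ℕ) : (1 : ℝ) ∈ PiInf r := by
  refine ⟨∅, hasTuranDensity_iff_tendsto_exDeficit.2 ?_⟩
  have h : ∀ n, exDeficit r ∅ n = 0 := fun n => by
    let G : HGraph r := ⟨n, Finset.powersetCard r Finset.univ,
      fun e he => (Finset.mem_powersetCard.1 he).2⟩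
    have hG : IsFree ∅ G := fun H hH => absurd hH (Set.notMem_empty H)
    have h1 : (Finset.powersetCard r (Finset.univ : Finset (Fin n))).card ≤ exNum r ∅ n :=
      hG.card_edges_le_exNum
    rw [Finset.card_powersetCard, Finset.card_univ, Fintype.card_fin] at h1
    exact Nat.sub_eq_zero_of_le h1
  simp [h]

/-- The intervals `[B / m ^ p, A / m ^ p]` cover a right neighbourhood of `0`. -/
lemma exists_mul_pow_mem_Icc {A B : ℝ} (hB : 0 ≤ B) (hAB : B < A) {p : ℕ} (hp : 1 ≤ p) :
    ∃ δ : ℝ, 0 < δ ∧ ∀ s, 0 < s → s ≤ δ → ∃ m : ℕ, 1 ≤ m ∧ s * (m : ℝ) ^ p ∈ Set.Icc B A := by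
  have hA : 0 < A := hB.trans_lt hAB
  have hlim : Tendsto (fun n : ℕ => A * ((n : ℝ) / (n + 1)) ^ p) atTop (nhds A) := by
    simpa using ((tendsto_natCast_div_add_atTop (1 : ℝ)).pow p).const_mul A
  obtain ⟨M, hM⟩ := eventually_atTop.1 (hlim.eventually (lt_mem_nhds hAB))
  refine ⟨A / (M + 1 : ℝ) ^ p, by positivity, fun s hs hsδ => ?_⟩
  have hex : ∃ N : ℕ, A < s * (N : ℝ) ^ p := by
    have h1 : Tendsto (fun n : ℕ => s * (n : ℝ) ^ p) atTop atTop :=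
      ((tendsto_pow_atTop (by omega)).comp tendsto_natCast_atTop_atTop).const_mul_atTop hs
    exact (h1.eventually_gt_atTop A).exists
  have hN : A < s * (Nat.find hex : ℝ) ^ p := Nat.find_spec hex
  have hMN : M + 1 < Nat.find hex := by
    by_contra! hle
    have h1 : s * (Nat.find hex : ℝ) ^ p ≤ s * (M + 1 : ℝ) ^ p := by
      gcongr
      exact_mod_cast hle
    rw [le_div_iff₀ (by positivity)] at hsδ
    linarith
  obtain ⟨m, hm⟩ : ∃ m, Nat.find hex = m + 1 := ⟨Nat.find hex - 1, by omega⟩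
  have hmA : ¬ A < s * (m : ℝ) ^ p := Nat.find_min hex (by omega)
  rw [hm] at hN hMN
  refine ⟨m, by omega, ?_, not_lt.1 hmA⟩
  have h1 := hM m (by omega)
  have h2 : A * ((m : ℝ) / (m + 1)) ^ p ≤ s * (m : ℝ) ^ p := by
    push_cast at hN
    calc A * ((m : ℝ) / (m + 1)) ^ p ≤ s * (m + 1 : ℝ) ^ p * ((m : ℝ) / (m + 1)) ^ p := by gcongr
      _ = s * (m : ℝ) ^ p := by
        rw [div_pow]
        field_simp
  linarith

/-- If `Π^{(r)}_∞` contains a non-degenerate interval `[a,b]`, then it contains a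
terminal interval `[1-δ, 1]` for some `δ > 0`. -/
theorem terminal_interval_of_interval (r : ℕ) (hr : 3 ≤ r) (a b : ℝ) (hab : a < b)
    (h : Set.Icc a b ⊆ PiInf r) :
    ∃ δ : ℝ, 0 < δ ∧ Set.Icc (1 - δ) 1 ⊆ PiInf r := by
  have hb : b ≤ 1 := le_one_of_mem_piInf (h ⟨hab.le, le_rfl⟩)
  obtain ⟨δ, hδ, hcover⟩ := exists_mul_pow_mem_Icc (A := 1 - a) (B := 1 - b) (by linarith)
    (by linarith) (p := r - 1) (by omega)
  refine ⟨δ, hδ, fun t ht => ?_⟩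
  rcases ht.2.eq_or_lt with rfl | ht1
  · exact one_mem_piInf r
  obtain ⟨m, hm, hmB, hmA⟩ := hcover (1 - t) (by linarith) (by linarith [ht.1])
  have hmem : 1 - (1 - t) * (m : ℝ) ^ (r - 1) ∈ PiInf r := h ⟨by linarith, by linarith⟩
  have hm0 : (m : ℝ) ^ (r - 1) ≠ 0 := by positivity
  have := one_sub_div_pow_mem_piInf (by omega) hmem hm
  rwa [sub_sub_cancel, mul_div_cancel_right₀ _ hm0, sub_sub_cancel] at this
end
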